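/- arXiv:2601.13586 — 3 statements merged into one kernel-verified Lean document; each statement's English description precedes it below -/
import Mathlib

section
/- Assume μ₂ ≥ μ₁ and h₁/μ₁ ≥ h₂/μ₂. Then for every (i,k,ℓ) ∈ X_diff with ℓ < C₂, D(i,k,ℓ) ≥ 0. If moreover the inequality h₁/μ₁ > h₂/μ₂ holds strictly, then D(i,k,ℓ) > 0 for every such state. -/
/-- Overall service rate `d(k,ℓ) = k·μ₁ + min(ℓ,C₂)·μ₂`. -/
noncomputable def dRate (C₂ : ℕ) (μ₁ μ₂ : ℝ) (k ℓ : ℕ) : ℝ :=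
  (k : ℝ) * μ₁ + ((min ℓ C₂ : ℕ) : ℝ) * μ₂

/-- Membership of `(i,k,ℓ)` in the state space `X`. -/
def memX (C₁ : ℕ) (i k ℓ : ℕ) : Prop :=
  (i = 0 ∧ k + ℓ < C₁) ∨ k + ℓ = C₁

/-- `v` satisfies the optimality (Bellman) equations of the clearing system.
Terms whose coefficient `k·μ₁` or `min(ℓ,C₂)·μ₂` vanishes contribute `0`,
matching the convention that such summands are omitted. -/
def IsValue (C₁ C₂ : ℕ) (μ₁ μ₂ h₀ h₁ h₂ : ℝ) (v : ℕ → ℕ → ℕ → ℝ) : Prop :=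
  v 0 0 0 = 0 ∧
  (∀ k ℓ : ℕ, k + ℓ ≤ C₁ → ¬(k = 0 ∧ ℓ = 0) →
    v 0 k ℓ = ((k : ℝ) * h₁ + (ℓ : ℝ) * h₂) / dRate C₂ μ₁ μ₂ k ℓ
      + ((k : ℝ) * μ₁ / dRate C₂ μ₁ μ₂ k ℓ) * v 0 (k - 1) ℓ
      + (((min ℓ C₂ : ℕ) : ℝ) * μ₂ / dRate C₂ μ₁ μ₂ k ℓ) * v 0 k (ℓ - 1)) ∧
  (∀ i k ℓ : ℕ, k + ℓ = C₁ →
    v (i + 1) k ℓ =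
      (((i : ℝ) + 1) * h₀ + (k : ℝ) * h₁ + (ℓ : ℝ) * h₂) / dRate C₂ μ₁ μ₂ k ℓ
      + ((k : ℝ) * μ₁ / dRate C₂ μ₁ μ₂ k ℓ) *
          min (v i k ℓ) (v i (k - 1) (ℓ + 1))
      + (((min ℓ C₂ : ℕ) : ℝ) * μ₂ / dRate C₂ μ₁ μ₂ k ℓ) *
          min (v i (k + 1) (ℓ - 1)) (v i k ℓ))

/-- The difference `D(i,k,ℓ) = v(i,k,ℓ) − v(i,k−1,ℓ+1)`. -/
noncomputable def Dv (v : ℕ → ℕ → ℕ → ℝ) (i k ℓ : ℕ) : ℝ :=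
  v i k ℓ - v i (k - 1) (ℓ + 1)

lemma v0_formula
    (C₁ C₂ : ℕ) (μ₁ μ₂ h₀ h₁ h₂ : ℝ)
    (hμ₁ : 0 < μ₁) (hμ₂ : 0 < μ₂)
    (v : ℕ → ℕ → ℕ → ℝ) (hv : IsValue C₁ C₂ μ₁ μ₂ h₀ h₁ h₂ v) :
    ∀ n k ℓ : ℕ, k + ℓ = n → k + ℓ ≤ C₁ → ℓ ≤ C₂ →
      v 0 k ℓ = k * (h₁ / μ₁) + ℓ * (h₂ / μ₂) := by
  obtain ⟨hz, h0, -⟩ := hv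
  intro n
  induction n with
  | zero =>
    intro k ℓ hn _ _
    obtain ⟨rfl, rfl⟩ : k = 0 ∧ ℓ = 0 := by omega
    simp [hz]
  | succ n ih =>
    intro k ℓ hn hC hℓ
    have e := h0 k ℓ hC (by omega)
    rw [dRate, min_eq_left hℓ] at e
    have d : 0 < (k : ℝ) * μ₁ + ℓ * μ₂ := by
      rcases Nat.eq_zero_or_pos k with h | h
      · have : 0 < (ℓ : ℝ) := by exact_mod_cast (by omega : 0 < ℓ)
        positivity
      · have : 0 < (k : ℝ) := by exact_mod_cast h
        positivity
    have A : (k : ℝ) * v 0 (k - 1) ℓ = k * ((k - 1) * (h₁ / μ₁) + ℓ * (h₂ / μ₂)) := by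
      rcases k with _ | k
      · simp
      · rw [Nat.add_sub_cancel, ih k ℓ (by omega) (by omega) hℓ]; push_cast; ring
    have B : (ℓ : ℝ) * v 0 k (ℓ - 1) = ℓ * (k * (h₁ / μ₁) + (ℓ - 1) * (h₂ / μ₂)) := by
      rcases ℓ with _ | ℓ
      · simp
      · rw [Nat.add_sub_cancel, ih k ℓ (by omega) (by omega) (by omega)]; push_cast; ring
    have e2 : v 0 k ℓ = ((k : ℝ) * h₁ + ℓ * h₂ + μ₁ * ((k : ℝ) * v 0 (k - 1) ℓ)
        + μ₂ * ((ℓ : ℝ) * v 0 k (ℓ - 1))) / ((k : ℝ) * μ₁ + ℓ * μ₂) := by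
      rw [e]; ring
    rw [e2, A, B, div_eq_iff d.ne']
    field_simp
    ring

lemma step_bound
    (C₁ C₂ : ℕ) (μ₁ μ₂ h₀ h₁ h₂ : ℝ)
    (hμ₁ : 0 < μ₁) (hμ₂ : 0 < μ₂) (hh₀ : 0 < h₀)
    (v : ℕ → ℕ → ℕ → ℝ) (hv : IsValue C₁ C₂ μ₁ μ₂ h₀ h₁ h₂ v)
    (hμ : μ₁ ≤ μ₂) (i k ℓ : ℕ) (hk : k + 1 + ℓ = C₁) (hℓ : ℓ < C₂)
    (ih : ∀ k ℓ : ℕ, k + 1 + ℓ = C₁ → ℓ < C₂ → v i k (ℓ + 1) ≤ v i (k + 1) ℓ) :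
    ((k : ℝ) + 1 + ℓ) * (h₁ * μ₂ - h₂ * μ₁) /
      ((((k : ℝ) + 1) * μ₁ + ℓ * μ₂) * ((k : ℝ) * μ₁ + (ℓ + 1) * μ₂))
      ≤ v (i + 1) (k + 1) ℓ - v (i + 1) k (ℓ + 1) := by
  obtain ⟨-, -, h⟩ := hv
  have e1 := h i (k + 1) ℓ hk
  have e2 := h i k (ℓ + 1) (by omega)
  rw [dRate, min_eq_left hℓ.le] at e1
  rw [dRate, min_eq_left (by omega : ℓ + 1 ≤ C₂)] at e2
  simp only [Nat.add_sub_cancel] at e1 e2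
  push_cast at e1 e2
  set a := v i k (ℓ + 1) with ha
  have d1 : 0 < ((k : ℝ) + 1) * μ₁ + ℓ * μ₂ := by positivity
  have d2 : 0 < (k : ℝ) * μ₁ + (ℓ + 1) * μ₂ := by positivity
  have hka := ih k ℓ hk hℓ
  have m1 : min (v i (k + 1) ℓ) a = a := min_eq_right hka
  have m2 : (ℓ : ℝ) * a ≤ ℓ * min (v i (k + 1 + 1) (ℓ - 1)) (v i (k + 1) ℓ) := by
    rcases ℓ with _ | ℓ
    · simp
    · apply mul_le_mul_of_nonneg_left _ (Nat.cast_nonneg _)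
      have := ih (k + 1) ℓ (by omega) (by omega)
      simp only [Nat.add_sub_cancel]
      exact le_min (hka.trans this) hka
  have m3 : min a (v i (k - 1) (ℓ + 1 + 1)) ≤ a := min_le_left _ _
  have m4 : min (v i (k + 1) ℓ) a ≤ a := min_le_right _ _
  have L : (((i : ℝ) + 1) * h₀ + (k + 1) * h₁ + ℓ * h₂) / (((k : ℝ) + 1) * μ₁ + ℓ * μ₂) + a
      ≤ v (i + 1) (k + 1) ℓ := by
    rw [e1, m1, div_add' _ _ _ d1.ne', div_mul_eq_mul_div, div_mul_eq_mul_div, ← add_div,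
      ← add_div]
    apply div_le_div_of_nonneg_right _ d1.le
    have := mul_le_mul_of_nonneg_left m2 hμ₂.le
    linarith
  have U : v (i + 1) k (ℓ + 1) ≤
      (((i : ℝ) + 1) * h₀ + k * h₁ + (ℓ + 1) * h₂) / ((k : ℝ) * μ₁ + (ℓ + 1) * μ₂) + a := by
    rw [e2, div_mul_eq_mul_div, div_mul_eq_mul_div, ← add_div, ← add_div,
      div_add' _ _ _ d2.ne']
    apply div_le_div_of_nonneg_right _ d2.le
    have := mul_le_mul_of_nonneg_left m3 (by positivity : 0 ≤ (k : ℝ) * μ₁)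
    have := mul_le_mul_of_nonneg_left m4 (by positivity : 0 ≤ ((ℓ : ℝ) + 1) * μ₂)
    linarith
  have key : ((k : ℝ) + 1 + ℓ) * (h₁ * μ₂ - h₂ * μ₁) /
      ((((k : ℝ) + 1) * μ₁ + ℓ * μ₂) * ((k : ℝ) * μ₁ + (ℓ + 1) * μ₂)) ≤
      (((i : ℝ) + 1) * h₀ + (k + 1) * h₁ + ℓ * h₂) / (((k : ℝ) + 1) * μ₁ + ℓ * μ₂) -
      (((i : ℝ) + 1) * h₀ + k * h₁ + (ℓ + 1) * h₂) / ((k : ℝ) * μ₁ + (ℓ + 1) * μ₂) := by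
    rw [div_sub_div _ _ d1.ne' d2.ne']
    apply div_le_div_of_nonneg_right _ (by positivity)
    have : 0 ≤ ((i : ℝ) + 1) * h₀ * (μ₂ - μ₁) :=
      mul_nonneg (by positivity) (by linarith)
    linarith
  linarith

theorem stmt2
    (C₁ C₂ : ℕ) (hC₂pos : 1 ≤ C₂) (hC : C₂ < C₁)
    (μ₁ μ₂ h₀ h₁ h₂ : ℝ)
    (hμ₁ : 0 < μ₁) (hμ₂ : 0 < μ₂)
    (hh₀ : 0 < h₀) (hh₁ : 0 < h₁) (hh₂ : 0 < h₂)
    (v : ℕ → ℕ → ℕ → ℝ) (hv : IsValue C₁ C₂ μ₁ μ₂ h₀ h₁ h₂ v)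
    (hμ : μ₁ ≤ μ₂) (hcost : h₂ / μ₂ ≤ h₁ / μ₁) :
    (∀ i k ℓ : ℕ, memX C₁ i k ℓ → 1 ≤ k → ℓ < C₂ → 0 ≤ Dv v i k ℓ) ∧
    (h₂ / μ₂ < h₁ / μ₁ →
      ∀ i k ℓ : ℕ, memX C₁ i k ℓ → 1 ≤ k → ℓ < C₂ → 0 < Dv v i k ℓ) := by
  have z : ∀ k ℓ : ℕ, k + 1 + ℓ ≤ C₁ → ℓ < C₂ →
      v 0 (k + 1) ℓ - v 0 k (ℓ + 1) = h₁ / μ₁ - h₂ / μ₂ := by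
    intro k ℓ hk hℓ
    rw [v0_formula C₁ C₂ μ₁ μ₂ h₀ h₁ h₂ hμ₁ hμ₂ v hv _ (k + 1) ℓ rfl hk hℓ.le,
      v0_formula C₁ C₂ μ₁ μ₂ h₀ h₁ h₂ hμ₁ hμ₂ v hv _ k (ℓ + 1) rfl (by omega) hℓ]
    push_cast
    ring
  have hc : 0 ≤ h₁ * μ₂ - h₂ * μ₁ := by
    rw [div_le_div_iff₀ hμ₂ hμ₁] at hcost
    linarith
  have w : ∀ i k ℓ : ℕ, k + 1 + ℓ = C₁ → ℓ < C₂ → v i k (ℓ + 1) ≤ v i (k + 1) ℓ := by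
    intro i
    induction i with
    | zero =>
      intro k ℓ hk hℓ
      have := z k ℓ hk.le hℓ
      linarith
    | succ i ih =>
      intro k ℓ hk hℓ
      have := step_bound C₁ C₂ μ₁ μ₂ h₀ h₁ h₂ hμ₁ hμ₂ hh₀ v hv hμ i k ℓ hk hℓ ih
      have p : 0 ≤ ((k : ℝ) + 1 + ℓ) * (h₁ * μ₂ - h₂ * μ₁) /
        ((((k : ℝ) + 1) * μ₁ + ℓ * μ₂) * ((k : ℝ) * μ₁ + (ℓ + 1) * μ₂)) := by positivity
      linarith
  constructor
  · intro i k ℓ hX hk hℓ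
    obtain ⟨k, rfl⟩ : ∃ j, k = j + 1 := ⟨k - 1, by omega⟩
    rw [Dv, Nat.add_sub_cancel]
    rcases hX with ⟨rfl, hX⟩ | hX
    · rw [z k ℓ hX.le hℓ]; linarith
    · have := w i k ℓ hX hℓ
      linarith
  · intro hs i k ℓ hX hk hℓ
    obtain ⟨k, rfl⟩ : ∃ j, k = j + 1 := ⟨k - 1, by omega⟩
    rw [Dv, Nat.add_sub_cancel]
    have hc' : 0 < h₁ * μ₂ - h₂ * μ₁ := by
      rw [div_lt_div_iff₀ hμ₂ hμ₁] at hs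
      linarith
    rcases i with _ | i
    · rw [z k ℓ (by rcases hX with h | h <;> omega) hℓ]; linarith
    · have hX' : k + 1 + ℓ = C₁ := by rcases hX with h | h <;> omega
      have := step_bound C₁ C₂ μ₁ μ₂ h₀ h₁ h₂ hμ₁ hμ₂ hh₀ v hv hμ i k ℓ hX' hℓ (w i)
      have p : 0 < ((k : ℝ) + 1 + ℓ) * (h₁ * μ₂ - h₂ * μ₁) /
        ((((k : ℝ) + 1) * μ₁ + ℓ * μ₂) * ((k : ℝ) * μ₁ + (ℓ + 1) * μ₂)) := by positivity
      linarith
end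

section
/- For every i, k, ℓ such that both (i,k,ℓ) ∈ X_diff and (i,k+1,ℓ−1) ∈ X_diff (in particular ℓ ≥ 1), one has D(i,k+1,ℓ−1) − D(i,k,ℓ) ≥ 0; equivalently, v(i,k+1,ℓ−1) − v(i,k,ℓ) ≥ v(i,k,ℓ) − v(i,k−1,ℓ+1). -/
namespace Clearing

/-- The median-type quantity `W(k) = D(k)⁺ - D(k+1)⁻`. -/
noncomputable def Wf (C : ℕ) (D : ℕ → ℝ) (k : ℕ) : ℝ :=
  (if 1 ≤ k then max (D k) 0 else 0) + (if k < C then min (D (k + 1)) 0 else 0)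

def Conv (C : ℕ) (D : ℕ → ℝ) : Prop := ∀ k, 1 ≤ k → k < C → D k ≤ D (k + 1)

section W
variable {C : ℕ} {D : ℕ → ℝ}

lemma D_le_W (h : Conv C D) {k : ℕ} (h1 : 1 ≤ k) (h2 : k ≤ C) : D k ≤ Wf C D k := by
  unfold Wf
  rw [if_pos h1]
  split_ifs with hk
  · have := h k h1 hk
    rcases le_total (D k) 0 with h3 | h3 <;> rcases le_total (D (k+1)) 0 with h4 | h4 <;>
      simp [h3, h4] <;> linarith
  · simp

lemma W_le_D (h : Conv C D) {k : ℕ} (h2 : k < C) : Wf C D k ≤ D (k + 1) := by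
  unfold Wf
  rw [if_pos h2]
  split_ifs with hk
  · have := h k hk h2
    rcases le_total (D k) 0 with h3 | h3 <;> rcases le_total (D (k+1)) 0 with h4 | h4 <;>
      simp [h3, h4] <;> linarith
  · simp

lemma W_mono (h : Conv C D) {k : ℕ} (h2 : k < C) : Wf C D k ≤ Wf C D (k + 1) :=
  (W_le_D h h2).trans (D_le_W h (by omega) (by omega))

lemma W_pos (h : Conv C D) {k : ℕ} (h2 : k ≤ C) (hW : 0 < Wf C D k) :
    1 ≤ k ∧ Wf C D k = D k := by
  unfold Wf at *
  split_ifs at * with h3 h4 h4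
  · refine ⟨h3, ?_⟩
    have := h k h3 h4
    rcases le_total (D k) 0 with h5 | h5 <;> rcases le_total (D (k+1)) 0 with h6 | h6 <;>
      simp [h5, h6] at hW ⊢ <;> linarith
  · refine ⟨h3, ?_⟩
    rcases le_total (D k) 0 with h5 | h5 <;> simp [h5] at hW ⊢
  · have := min_le_right (D (k+1)) 0
    linarith
  · linarith

lemma W_neg (h : Conv C D) {k : ℕ} (hW : Wf C D k < 0) :
    k < C ∧ Wf C D k = D (k + 1) := by
  unfold Wf at *
  split_ifs at * with h3 h4 h4
  · refine ⟨h4, ?_⟩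
    have := h k h3 h4
    rcases le_total (D k) 0 with h5 | h5 <;> rcases le_total (D (k+1)) 0 with h6 | h6 <;>
      simp [h5, h6] at hW ⊢ <;> linarith
  · have := le_max_right (D k) 0
    linarith
  · refine ⟨h4, ?_⟩
    rcases le_total (D (k+1)) 0 with h5 | h5 <;> simp [h5] at hW ⊢
  · linarith

lemma D_pos {k : ℕ} (h : Conv C D) (h1 : 1 ≤ k) (h2 : k ≤ C) (hD : 0 < D k) : Wf C D k = D k :=
  (W_pos h h2 (hD.trans_le (D_le_W h h1 h2))).2

lemma D_nonpos {k : ℕ} (h1 : 1 ≤ k) (hD : D k ≤ 0) : Wf C D k ≤ 0 := by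
  unfold Wf
  rw [if_pos h1, max_eq_right hD]
  split_ifs <;> simp

/-- if `D k > 0` then `W (k-1) ≥ 0` -/
lemma W_pred_nonneg {k : ℕ} (hD : 0 ≤ D (k + 1)) : 0 ≤ Wf C D k := by
  unfold Wf
  split_ifs <;> simp [hD]

end W

/-- Parameters. `K = C₁ - C₂`. -/
structure Par where
  C : ℕ
  K : ℕ
  m1 : ℝ
  m2 : ℝ
  h0 : ℝ
  h1 : ℝ
  h2 : ℝ
  hK : 1 ≤ K
  hKC : K < C
  m1p : 0 < m1
  m2p : 0 < m2
  h0p : 0 < h0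
  h1p : 0 < h1
  h2p : 0 < h2

variable (P : Par)

noncomputable def a (k : ℕ) : ℝ := k * P.m1
noncomputable def b (k : ℕ) : ℝ := min ((P.C : ℝ) - k) ((P.C : ℝ) - P.K) * P.m2
noncomputable def d (k : ℕ) : ℝ := a P k + b P k
noncomputable def cost (c : ℝ) (k : ℕ) : ℝ := c + k * P.h1 + ((P.C : ℝ) - k) * P.h2
noncomputable def p (c : ℝ) (D : ℕ → ℝ) (k : ℕ) : ℝ := (cost P c k + b P k * Wf P.C D k) / d P k
noncomputable def q (c : ℝ) (D : ℕ → ℝ) (k : ℕ) : ℝ := (cost P c k - a P k * Wf P.C D k) / d P k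
noncomputable def dl : ℝ := P.h1 / P.m1 - P.h2 / P.m2

lemma b_lo {k : ℕ} (h : k ≤ P.K) : b P k = ((P.C : ℝ) - P.K) * P.m2 := by
  have : (k : ℝ) ≤ P.K := by exact_mod_cast h
  unfold b; rw [min_eq_right (by linarith)]

lemma b_hi {k : ℕ} (h : P.K ≤ k) : b P k = ((P.C : ℝ) - k) * P.m2 := by
  have : (P.K : ℝ) ≤ k := by exact_mod_cast h
  unfold b; rw [min_eq_left (by linarith)]

lemma a_nonneg (k : ℕ) : 0 ≤ a P k := by
  have := P.m1p
  unfold a; positivity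

lemma b_nonneg {k : ℕ} (h : k ≤ P.C) : 0 ≤ b P k := by
  have := P.m2p
  have h1 : (k : ℝ) ≤ P.C := by exact_mod_cast h
  have h2 : (P.K : ℝ) < P.C := by exact_mod_cast P.hKC
  unfold b
  exact mul_nonneg (le_min (by linarith) (by linarith)) this.le

lemma b_anti (k : ℕ) : b P (k + 1) ≤ b P k := by
  have := P.m2p
  unfold b
  push_cast
  gcongr
  linarith

lemma d_pos {k : ℕ} (h : k ≤ P.C) : 0 < d P k := by
  unfold d
  rcases Nat.eq_zero_or_pos k with h1 | h1
  · have h2 : (P.K : ℝ) < P.C := by exact_mod_cast P.hKC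
    rw [b_lo P (by omega)]
    have := mul_pos (sub_pos.2 h2) P.m2p
    have := a_nonneg P k
    linarith
  · have := b_nonneg P h
    have : 0 < a P k := by
      have := P.m1p
      unfold a; positivity
    linarith

lemma cost_pos {c : ℝ} (hc : 0 < c) {k : ℕ} (h : k ≤ P.C) : 0 < cost P c k := by
  have := P.h1p
  have := P.h2p
  have h1 : (0 : ℝ) ≤ (P.C : ℝ) - k := by
    have : (k : ℝ) ≤ P.C := by exact_mod_cast h
    linarith
  unfold cost; positivity

variable {P}
variable {c : ℝ} {D : ℕ → ℝ}

lemma hp {k : ℕ} (h : k ≤ P.C) : d P k * p P c D k = cost P c k + b P k * Wf P.C D k := by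
  have := d_pos P h
  unfold p; field_simp

lemma hq {k : ℕ} (h : k ≤ P.C) : d P k * q P c D k = cost P c k - a P k * Wf P.C D k := by
  have := d_pos P h
  unfold q; field_simp

lemma hpq {k : ℕ} (h : k ≤ P.C) : p P c D k = q P c D k + Wf P.C D k := by
  have := d_pos P h
  have h1 := hp (c := c) (D := D) h
  have h2 := hq (c := c) (D := D) h
  have h3 : d P k = a P k + b P k := rfl
  apply mul_left_cancel₀ this.ne'
  rw [h1, mul_add, h2, h3]; ring

structure Inv (P : Par) (c : ℝ) (D : ℕ → ℝ) : Prop where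
  conv : Conv P.C D
  pn : ∀ k ≤ P.C, 0 ≤ p P c D k
  qn : ∀ k ≤ P.C, 0 ≤ q P c D k
  I1 : ∀ k, 1 ≤ k → k ≤ P.C → Wf P.C D k ≤ 0 → P.h1 - P.h2 ≤ P.m1 * p P c D k
  I2 : P.m2 ≤ P.m1 → ∀ k, P.K < k → k ≤ P.C → Wf P.C D k ≤ 0 →
    P.h1 - P.h2 ≤ P.m1 * p P c D k - P.m2 * q P c D k
  Z : P.m1 < P.m2 → ∀ k, P.K < k → k ≤ P.C →
    P.C * P.m1 * P.m2 * (D k - dl P) + (P.m1 - P.m2) * c ≤ 0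
  Q : ∀ k, k + 1 ≤ P.C → (k + 1 ≤ P.K ∨ P.m2 ≤ P.m1) → q P c D (k + 1) ≤ q P c D k

/-- `d_k (μ₁ p - μ₂ q - (h₁ - h₂)) = s c + C μ₁ μ₂ (W - δ)` for `k ≥ K` -/
lemma hR {k : ℕ} (hK : P.K ≤ k) (h : k ≤ P.C) :
    d P k * (P.m1 * p P c D k - P.m2 * q P c D k - (P.h1 - P.h2)) =
      P.C * P.m1 * P.m2 * (Wf P.C D k - dl P) + (P.m1 - P.m2) * c := by
  have h1 := hp (c := c) (D := D) h
  have h2 := hq (c := c) (D := D) h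
  have e1 : P.m1 * P.m2 * dl P = P.h1 * P.m2 - P.h2 * P.m1 := by
    have := P.m1p
    have := P.m2p
    unfold dl; field_simp
  have h3 : d P k = a P k + b P k := rfl
  have h4 := b_hi P hK
  have h5 : a P k = k * P.m1 := rfl
  have h6 : cost P c k = c + k * P.h1 + ((P.C : ℝ) - k) * P.h2 := rfl
  rw [h6, h4] at h1
  rw [h6, h5] at h2
  rw [h4, h5] at h3
  linear_combination P.m1 * h1 - P.m2 * h2 + P.C * e1 - (P.h1 - P.h2) * h3

/-- q-monotonicity from `I1`/`I2` type bounds. -/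
lemma Q_of_lo (hc : Conv P.C D) {k : ℕ} (hk : k + 1 ≤ P.K)
    (h : P.h1 - P.h2 ≤ P.m1 * p P c D (k + 1)) : q P c D (k + 1) ≤ q P c D k := by
  have hKC := P.hKC
  have hW := W_mono hc (k := k) (by omega)
  have h1 := hq (P := P) (c := c) (D := D) (k := k + 1) (by omega)
  have h2 := hq (P := P) (c := c) (D := D) (k := k) (by omega)
  have h3 := hpq (P := P) (c := c) (D := D) (k := k + 1) (by omega)
  have dp := d_pos P (k := k) (by omega)
  have e1 : d P k = d P (k + 1) - P.m1 := by
    unfold d a; rw [b_lo P hk, b_lo P (k := k) (by omega)]; push_cast; ring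
  have e2 : a P (k + 1) = a P k + P.m1 := by unfold a; push_cast; ring
  have e3 : cost P c (k + 1) = cost P c k + (P.h1 - P.h2) := by unfold cost; push_cast; ring
  have key : d P k * (q P c D k - q P c D (k + 1)) =
      a P k * (Wf P.C D (k + 1) - Wf P.C D k) + (P.m1 * p P c D (k + 1) - (P.h1 - P.h2)) := by
    rw [e2, e3] at h1
    linear_combination h2 - h1 - q P c D (k + 1) * e1 - P.m1 * h3
  have := mul_nonneg (a_nonneg P k) (sub_nonneg.2 hW)
  by_contra hcon
  push Not at hcon
  have := mul_neg_of_pos_of_neg dp (sub_neg.2 hcon)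
  linarith

lemma Q_of_hi (hc : Conv P.C D) {k : ℕ} (hk : P.K ≤ k) (hkC : k + 1 ≤ P.C)
    (h : P.h1 - P.h2 ≤ P.m1 * p P c D (k + 1) - P.m2 * q P c D (k + 1)) :
    q P c D (k + 1) ≤ q P c D k := by
  have hKC := P.hKC
  have hW := W_mono hc (k := k) (by omega)
  have h1 := hq (P := P) (c := c) (D := D) (k := k + 1) (by omega)
  have h2 := hq (P := P) (c := c) (D := D) (k := k) (by omega)
  have h3 := hpq (P := P) (c := c) (D := D) (k := k + 1) (by omega)
  have dp := d_pos P (k := k) (by omega)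
  have e1 : d P k = d P (k + 1) - P.m1 + P.m2 := by
    unfold d a; rw [b_hi P hk, b_hi P (k := k + 1) (by omega)]; push_cast; ring
  have e2 : a P (k + 1) = a P k + P.m1 := by unfold a; push_cast; ring
  have e3 : cost P c (k + 1) = cost P c k + (P.h1 - P.h2) := by unfold cost; push_cast; ring
  have key : d P k * (q P c D k - q P c D (k + 1)) =
      a P k * (Wf P.C D (k + 1) - Wf P.C D k) +
      (P.m1 * p P c D (k + 1) - P.m2 * q P c D (k + 1) - (P.h1 - P.h2)) := by
    rw [e2, e3] at h1
    linear_combination h2 - h1 - q P c D (k + 1) * e1 - P.m1 * h3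
  have := mul_nonneg (a_nonneg P k) (sub_nonneg.2 hW)
  by_contra hcon
  push Not at hcon
  have := mul_neg_of_pos_of_neg dp (sub_neg.2 hcon)
  linarith

/-- p-monotonicity for `μ₁ < μ₂` above the kink. -/
lemma p_inc (hI : Inv P c D) (hs : P.m1 < P.m2) {k : ℕ} (hk : P.K ≤ k) (hkC : k + 1 ≤ P.C) :
    p P c D k ≤ p P c D (k + 1) := by
  have hKC := P.hKC
  have hW := W_mono hI.conv (k := k) (by omega)
  have h1 := hp (P := P) (c := c) (D := D) (k := k + 1) (by omega)
  have h2 := hp (P := P) (c := c) (D := D) (k := k) (by omega)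
  have h3 := hpq (P := P) (c := c) (D := D) (k := k) (by omega)
  have dp := d_pos P (k := k) (by omega)
  have dp' := d_pos P (k := k + 1) (by omega)
  have hz := hI.Z hs (k + 1) (by omega) hkC
  have hWD := W_le_D hI.conv (k := k) (by omega)
  have hR' := hR (P := P) (c := c) (D := D) hk (by omega)
  have hRn : P.m1 * p P c D k - P.m2 * q P c D k - (P.h1 - P.h2) ≤ 0 := by
    have h5 : (P.C : ℝ) * P.m1 * P.m2 * (Wf P.C D k - dl P) ≤
        P.C * P.m1 * P.m2 * (D (k + 1) - dl P) := by
      have := P.m1p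
      have := P.m2p
      gcongr
    by_contra hcon
    push Not at hcon
    have := mul_pos dp hcon
    linarith
  have e1 : d P k = d P (k + 1) - P.m1 + P.m2 := by
    unfold d a; rw [b_hi P hk, b_hi P (k := k + 1) (by omega)]; push_cast; ring
  have e2 : b P (k + 1) = b P k - P.m2 := by
    rw [b_hi P hk, b_hi P (k := k + 1) (by omega)]; push_cast; ring
  have e3 : cost P c (k + 1) = cost P c k + (P.h1 - P.h2) := by unfold cost; push_cast; ring
  have key : d P (k + 1) * (p P c D (k + 1) - p P c D k) =
      b P (k + 1) * (Wf P.C D (k + 1) - Wf P.C D k) -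
      (P.m1 * p P c D k - P.m2 * q P c D k - (P.h1 - P.h2)) := by
    rw [e3] at h1
    linear_combination h1 - h2 + p P c D k * e1 + P.m2 * h3 + Wf P.C D k * e2
  have := mul_nonneg (b_nonneg P hkC) (sub_nonneg.2 hW)
  by_contra hcon
  push Not at hcon
  have := mul_neg_of_pos_of_neg dp' (sub_neg.2 hcon)
  linarith

def Step (P : Par) (c : ℝ) (D D' : ℕ → ℝ) : Prop :=
  ∀ k, k + 1 ≤ P.C → D' (k + 1) = p P c D (k + 1) - q P c D k

lemma nonneg_of_mul {x y : ℝ} (hx : 0 < x) (h : 0 ≤ x * y) : 0 ≤ y := by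
  by_contra hcon
  push Not at hcon
  have := mul_neg_of_pos_of_neg hx hcon
  linarith

lemma step_conv (hI : Inv P c D) {D' : ℕ → ℝ} (hD : Step P c D D') : Conv P.C D' := by
  intro k hk1 hkC
  obtain ⟨j, rfl⟩ : ∃ j, k = j + 1 := ⟨k - 1, by omega⟩
  rw [hD j (by omega), hD (j + 1) (by omega), ← sub_nonneg]
  have hW0 := sub_nonneg.2 (W_mono hI.conv (k := j) (by omega))
  have hW1 := sub_nonneg.2 (W_mono hI.conv (k := j + 1) (by omega))
  have q0 := hq (P := P) (c := c) (D := D) (k := j) (by omega)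
  have q1 := hq (P := P) (c := c) (D := D) (k := j + 1) (by omega)
  have q2 := hq (P := P) (c := c) (D := D) (k := j + 1 + 1) (by omega)
  have p0 := hpq (P := P) (c := c) (D := D) (k := j) (by omega)
  have p1 := hpq (P := P) (c := c) (D := D) (k := j + 1) (by omega)
  have p2 := hpq (P := P) (c := c) (D := D) (k := j + 1 + 1) (by omega)
  have d0 := d_pos P (k := j) (by omega)
  have d2 := d_pos P (k := j + 1 + 1) (by omega)
  have b2 := b_nonneg P (k := j + 1 + 1) (by omega)
  have a0 := a_nonneg P j
  have ea1 : a P (j + 1) = a P j + P.m1 := by unfold a; push_cast; ring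
  have ea2 : a P (j + 1 + 1) = a P j + 2 * P.m1 := by unfold a; push_cast; ring
  have ec1 : cost P c (j + 1) = cost P c j + (P.h1 - P.h2) := by unfold cost; push_cast; ring
  have ec2 : cost P c (j + 1 + 1) = cost P c j + 2 * (P.h1 - P.h2) := by
    unfold cost; push_cast; ring
  have ed0 : d P j = a P j + b P j := rfl
  have ed1 : d P (j + 1) = a P (j + 1) + b P (j + 1) := rfl
  have ed2 : d P (j + 1 + 1) = a P (j + 1 + 1) + b P (j + 1 + 1) := rfl
  have m1p := P.m1p
  have m2p := P.m2p
  have qn1 := hI.qn (j + 1) (by omega)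
  rw [p1, p2]
  have Q1 := hI.Q j (by omega)
  generalize hQ0 : q P c D j = x0 at *
  generalize hQ1 : q P c D (j + 1) = x1 at *
  generalize hQ2 : q P c D (j + 1 + 1) = x2 at *
  have PI := fun hs hk => p_inc hI hs (k := j + 1) hk (by omega)
  rw [p1, p2] at PI
  generalize hV0 : Wf P.C D j = w0 at *
  generalize hV1 : Wf P.C D (j + 1) = w1 at *
  generalize hV2 : Wf P.C D (j + 1 + 1) = w2 at *
  have T0 := mul_nonneg a0 hW0
  have T2 := mul_nonneg b2 hW1
  rcases lt_trichotomy (j + 1) P.K with hlt | heq | hgt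
  · have eb0 : b P j = b P (j + 1 + 1) := by rw [b_lo P (by omega), b_lo P (by omega)]
    have eb1 : b P (j + 1) = b P (j + 1 + 1) := by rw [b_lo P (by omega), b_lo P (by omega)]
    have hQ := mul_nonneg m1p.le (sub_nonneg.2 (Q1 (Or.inl (by omega))))
    refine nonneg_of_mul d2 ?_
    have : d P (j + 1 + 1) * (x2 + w2 - x1 - (x1 + w1 - x0)) =
      a P j * (w1 - w0) + b P (j + 1 + 1) * (w2 - w1) + 2 * (P.m1 * (x0 - x1)) := by
      rw [ed0, eb0] at q0
      rw [ed1, eb1, ec1, ea1] at q1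
      rw [ed2, ec2, ea2] at q2
      rw [ed2, ea2]
      linear_combination q2 - 2 * q1 + q0
    linarith
  · have eb0 : b P j = b P (j + 1 + 1) + P.m2 := by
      rw [b_lo P (by omega), b_hi P (by omega), ← heq]; push_cast; ring
    have eb1 : b P (j + 1) = b P (j + 1 + 1) + P.m2 := by
      rw [b_lo P (by omega), b_hi P (by omega), ← heq]; push_cast; ring
    have hQ := sub_nonneg.2 (Q1 (Or.inl (by omega)))
    have T3 := mul_nonneg m2p.le qn1
    rcases le_total P.m2 (2 * P.m1) with hm | hm
    · refine nonneg_of_mul d2 ?_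
      have : d P (j + 1 + 1) * (x2 + w2 - x1 - (x1 + w1 - x0)) =
        a P j * (w1 - w0) + b P (j + 1 + 1) * (w2 - w1) + (2 * P.m1 - P.m2) * (x0 - x1)
          + P.m2 * x1 := by
        rw [ed0, eb0] at q0
        rw [ed1, eb1, ec1, ea1] at q1
        rw [ed2, ec2, ea2] at q2
        rw [ed2, ea2]
        linear_combination q2 - 2 * q1 + q0
      have := mul_nonneg (sub_nonneg.2 hm) hQ
      linarith
    · refine nonneg_of_mul d0 ?_
      have : d P j * (x2 + w2 - x1 - (x1 + w1 - x0)) =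
        a P j * (w1 - w0) + b P (j + 1 + 1) * (w2 - w1)
          + (P.m2 - 2 * P.m1) * (x2 + w2 - (x1 + w1)) + P.m2 * x1 := by
        rw [ed0, eb0] at q0
        rw [ed1, eb1, ec1, ea1] at q1
        rw [ed2, ec2, ea2] at q2
        rw [ed0, eb0]
        linear_combination q2 - 2 * q1 + q0
      have := mul_nonneg (sub_nonneg.2 hm) (sub_nonneg.2 (PI (by linarith) (by omega)))
      linarith
  · have eb0 : b P j = b P (j + 1 + 1) + 2 * P.m2 := by
      rw [b_hi P (by omega), b_hi P (by omega)]; push_cast; ring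
    have eb1 : b P (j + 1) = b P (j + 1 + 1) + P.m2 := by
      rw [b_hi P (by omega), b_hi P (by omega)]; push_cast; ring
    rcases le_or_gt P.m2 P.m1 with hm | hm
    · have hQ := sub_nonneg.2 (Q1 (Or.inr hm))
      refine nonneg_of_mul d2 ?_
      have : d P (j + 1 + 1) * (x2 + w2 - x1 - (x1 + w1 - x0)) =
        a P j * (w1 - w0) + b P (j + 1 + 1) * (w2 - w1) + 2 * ((P.m1 - P.m2) * (x0 - x1)) := by
        rw [ed0, eb0] at q0
        rw [ed1, eb1, ec1, ea1] at q1
        rw [ed2, ec2, ea2] at q2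
        rw [ed2, ea2]
        linear_combination q2 - 2 * q1 + q0
      have := mul_nonneg (sub_nonneg.2 hm) hQ
      linarith
    · refine nonneg_of_mul d0 ?_
      have : d P j * (x2 + w2 - x1 - (x1 + w1 - x0)) =
        a P j * (w1 - w0) + b P (j + 1 + 1) * (w2 - w1)
          + 2 * ((P.m2 - P.m1) * (x2 + w2 - (x1 + w1))) := by
        rw [ed0, eb0] at q0
        rw [ed1, eb1, ec1, ea1] at q1
        rw [ed2, ec2, ea2] at q2
        rw [ed0, eb0]
        linear_combination q2 - 2 * q1 + q0
      have := mul_nonneg (sub_nonneg.2 hm.le) (sub_nonneg.2 (PI hm (by omega)))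
      linarith


lemma step_p {D' : ℕ → ℝ} (hD : Step P c D D') (hc' : Conv P.C D') {k : ℕ}
    (hW : Wf P.C D' k < 0) :
    d P k * p P (c + P.h0) D' k = P.h0 + a P k * p P c D k + b P k * p P c D (k + 1) := by
  obtain ⟨hk, hW⟩ := W_neg hc' hW
  have h1 := hp (P := P) (c := c + P.h0) (D := D') (k := k) hk.le
  have h2 := hp (P := P) (c := c) (D := D) (k := k) hk.le
  have h3 := hpq (P := P) (c := c) (D := D) (k := k) hk.le
  rw [hW, hD k hk] at h1
  have e : cost P (c + P.h0) k = cost P c k + P.h0 := by unfold cost; ring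
  have ed : d P k = a P k + b P k := rfl
  rw [e] at h1
  linear_combination h1 - h2 + p P c D k * ed + b P k * h3

lemma step_q {D' : ℕ → ℝ} (hD : Step P c D D') {k : ℕ} (hk : k + 1 ≤ P.C)
    (hW : Wf P.C D' (k + 1) = D' (k + 1)) :
    d P (k + 1) * q P (c + P.h0) D' (k + 1) =
      P.h0 + b P (k + 1) * q P c D (k + 1) + a P (k + 1) * q P c D k := by
  have h1 := hq (P := P) (c := c + P.h0) (D := D') (k := k + 1) hk
  have h2 := hq (P := P) (c := c) (D := D) (k := k + 1) hk
  have h3 := hpq (P := P) (c := c) (D := D) (k := k + 1) hk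
  rw [hW, hD k hk] at h1
  have e : cost P (c + P.h0) (k + 1) = cost P c (k + 1) + P.h0 := by unfold cost; ring
  have ed : d P (k + 1) = a P (k + 1) + b P (k + 1) := rfl
  rw [e] at h1
  linear_combination h1 - h2 + q P c D (k + 1) * ed - a P (k + 1) * h3

lemma step_pn (hc : 0 < c) (hI : Inv P c D) {D' : ℕ → ℝ} (hD : Step P c D D')
    (hc' : Conv P.C D') : ∀ k ≤ P.C, 0 ≤ p P (c + P.h0) D' k := by
  intro k hk
  have h0p := P.h0p
  refine nonneg_of_mul (d_pos P hk) ?_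
  have hb := b_nonneg P hk
  have ha := a_nonneg P k
  rcases le_or_gt 0 (Wf P.C D' k) with hW | hW
  · rw [hp hk]
    have := cost_pos P (c := c + P.h0) (by linarith) hk
    positivity
  · rw [step_p hD hc' hW]
    have h1 := hI.pn k hk
    have h2 := hI.pn (k + 1) (W_neg hc' hW).1
    positivity

lemma step_qn (hc : 0 < c) (hI : Inv P c D) {D' : ℕ → ℝ} (hD : Step P c D D')
    (hc' : Conv P.C D') : ∀ k ≤ P.C, 0 ≤ q P (c + P.h0) D' k := by
  intro k hk
  have h0p := P.h0p
  refine nonneg_of_mul (d_pos P hk) ?_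
  have hb := b_nonneg P hk
  have ha := a_nonneg P k
  rcases le_or_gt (Wf P.C D' k) 0 with hW | hW
  · rw [hq hk]
    have := cost_pos P (c := c + P.h0) (by linarith) hk
    have := mul_nonneg ha (neg_nonneg.2 hW)
    linarith
  · obtain ⟨h3, h4⟩ := W_pos hc' hk hW
    obtain ⟨j, rfl⟩ : ∃ j, k = j + 1 := ⟨k - 1, by omega⟩
    rw [step_q hD hk h4]
    have h1 := hI.qn (j + 1) hk
    have h2 := hI.qn j (by omega)
    positivity

lemma cross (hI : Inv P c D) {D' : ℕ → ℝ} (hD : Step P c D D')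
    {j : ℕ} (hk : j + 1 ≤ P.C) (hW : 0 < Wf P.C D (j + 1)) (hn : D' (j + 1) ≤ 0) :
    (P.h1 - P.h2) * d P (j + 1) ≤ (d P (j + 1) - d P j) * cost P c (j + 1) := by
  have h4 := (W_pos hI.conv hk hW).2
  have hWj : 0 ≤ Wf P.C D j := W_pred_nonneg (by rw [← h4]; exact hW.le)
  rw [hD j hk] at hn
  have h1 := hp (P := P) (c := c) (D := D) (k := j + 1) hk
  have h2 := hq (P := P) (c := c) (D := D) (k := j) (by omega)
  have d0 := d_pos P (k := j) (by omega)
  have d1 := d_pos P hk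
  have t1 := mul_nonneg (b_nonneg P hk) hW.le
  have t2 := mul_nonneg (a_nonneg P j) hWj
  have t3 : d P j * (d P (j + 1) * p P c D (j + 1)) ≤ d P (j + 1) * (d P j * q P c D j) := by
    have := mul_le_mul_of_nonneg_left (sub_nonpos.1 hn) (mul_pos d0 d1).le
    linarith
  have t4 : d P j * cost P c (j + 1) ≤ d P j * (d P (j + 1) * p P c D (j + 1)) :=
    mul_le_mul_of_nonneg_left (by linarith) d0.le
  have t5 : d P (j + 1) * (d P j * q P c D j) ≤ d P (j + 1) * cost P c j :=
    mul_le_mul_of_nonneg_left (by linarith) d1.le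
  have e3 : cost P c j = cost P c (j + 1) - (P.h1 - P.h2) := by unfold cost; push_cast; ring
  rw [e3] at t5
  linarith

lemma L1 (hc : 0 < c) (hI : Inv P c D) {D' : ℕ → ℝ} (hD : Step P c D D')
    {k : ℕ} (hk1 : 1 ≤ k) (hk : k ≤ P.C) (hn : D' k ≤ 0) :
    P.h1 - P.h2 ≤ P.m1 * p P c D k ∧ (P.h1 - P.h2) * d P k ≤ P.m1 * cost P c k := by
  have h1 := hp (P := P) (c := c) (D := D) (k := k) hk
  have hd := d_pos P hk
  have m1p := P.m1p
  have hb := b_nonneg P hk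
  rcases le_or_gt (Wf P.C D k) 0 with hW | hW
  · have h2 := hI.I1 k hk1 hk hW
    refine ⟨h2, ?_⟩
    have t1 := mul_le_mul_of_nonneg_right h2 hd.le
    have t2 := mul_nonneg m1p.le (mul_nonneg hb (neg_nonneg.2 hW))
    have : P.m1 * (d P k * p P c D k) = P.m1 * (cost P c k + b P k * Wf P.C D k) := by rw [h1]
    linarith
  · obtain ⟨j, rfl⟩ : ∃ j, k = j + 1 := ⟨k - 1, by omega⟩
    have h2 := cross hI hD hk hW hn
    have h3 : d P (j + 1) - d P j ≤ P.m1 := by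
      have := b_anti P j
      unfold d a; push_cast; linarith
    have h4 := mul_le_mul_of_nonneg_right h3 (cost_pos P hc hk).le
    have h5 := h2.trans h4
    refine ⟨?_, h5⟩
    have t2 := mul_nonneg m1p.le (mul_nonneg hb hW.le)
    have : P.m1 * (d P (j+1) * p P c D (j+1)) =
      P.m1 * (cost P c (j+1) + b P (j+1) * Wf P.C D (j+1)) := by rw [h1]
    refine sub_nonneg.1 (nonneg_of_mul hd ?_)
    linarith

lemma hpq' {k : ℕ} (hk : k ≤ P.C) : d P k * (P.m1 * p P c D k - P.m2 * q P c D k) =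
    (P.m1 - P.m2) * cost P c k + (P.m1 * b P k + P.m2 * a P k) * Wf P.C D k := by
  linear_combination P.m1 * hp (P := P) (c := c) (D := D) (k := k) hk
    - P.m2 * hq (P := P) (c := c) (D := D) (k := k) hk

lemma L2 (hm : P.m2 ≤ P.m1) (hI : Inv P c D) {D' : ℕ → ℝ} (hD : Step P c D D')
    {k : ℕ} (hk1 : P.K < k) (hk : k ≤ P.C) (hn : D' k ≤ 0) :
    P.h1 - P.h2 ≤ P.m1 * p P c D k - P.m2 * q P c D k ∧
      (P.h1 - P.h2) * d P k ≤ (P.m1 - P.m2) * cost P c k := by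
  have h1 := hpq' (P := P) (c := c) (D := D) (k := k) hk
  have hd := d_pos P hk
  have m1p := P.m1p
  have m2p := P.m2p
  have hb := b_nonneg P hk
  have ha := a_nonneg P k
  have hab : 0 ≤ P.m1 * b P k + P.m2 * a P k := by positivity
  rcases le_or_gt (Wf P.C D k) 0 with hW | hW
  · have h2 := hI.I2 hm k hk1 hk hW
    refine ⟨h2, ?_⟩
    have t1 := mul_le_mul_of_nonneg_right h2 hd.le
    have t2 := mul_nonneg hab (neg_nonneg.2 hW)
    linarith
  · obtain ⟨j, rfl⟩ : ∃ j, k = j + 1 := ⟨k - 1, by omega⟩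
    have h2 := cross hI hD hk hW hn
    have h3 : d P (j + 1) - d P j = P.m1 - P.m2 := by
      unfold d a; rw [b_hi P (by omega), b_hi P (by omega)]; push_cast; ring
    rw [h3] at h2
    refine ⟨?_, h2⟩
    have t2 := mul_nonneg hab hW.le
    refine sub_nonneg.1 (nonneg_of_mul hd ?_)
    linarith

lemma step_I1 (hc : 0 < c) (hI : Inv P c D) {D' : ℕ → ℝ} (hD : Step P c D D')
    (hc' : Conv P.C D') : ∀ k, 1 ≤ k → k ≤ P.C → Wf P.C D' k ≤ 0 →
      P.h1 - P.h2 ≤ P.m1 * p P (c + P.h0) D' k := by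
  intro k hk1 hk hW
  have hn := (D_le_W hc' hk1 hk).trans hW
  obtain ⟨l1, l2⟩ := L1 hc hI hD hk1 hk hn
  have hd := d_pos P hk
  have m1p := P.m1p
  have h0p := P.h0p
  refine sub_nonneg.1 (nonneg_of_mul hd ?_)
  have e : cost P (c + P.h0) k = cost P c k + P.h0 := by unfold cost; ring
  have t := mul_pos m1p h0p
  rcases hW.eq_or_lt with hW | hW
  · have h1 := hp (P := P) (c := c + P.h0) (D := D') (k := k) hk
    rw [hW, e] at h1
    have : P.m1 * (d P k * p P (c + P.h0) D' k) = P.m1 * (cost P c k + P.h0 + b P k * 0) := by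
      rw [h1]
    linarith
  · obtain ⟨h3, h4⟩ := W_neg hc' hW
    have l3 := (L1 hc hI hD (k := k + 1) (by omega) h3 (h4 ▸ hW.le)).1
    have h5 := step_p hD hc' hW
    have h6 : P.m1 * (d P k * p P (c + P.h0) D' k) = P.m1 *
      (P.h0 + a P k * p P c D k + b P k * p P c D (k + 1)) := by rw [h5]
    have t1 := mul_le_mul_of_nonneg_left l1 (a_nonneg P k)
    have t2 := mul_le_mul_of_nonneg_left l3 (b_nonneg P hk)
    have ed : d P k * (P.h1 - P.h2) = a P k * (P.h1 - P.h2) + b P k * (P.h1 - P.h2) := by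
      unfold d; ring
    linarith

/-- Recursion for the `Z`-quantity. -/
lemma hZ {k : ℕ} (hK : P.K ≤ k) (hk : k + 1 ≤ P.C) :
    P.C * P.m1 * P.m2 * (p P c D (k + 1) - q P c D k - dl P) + (P.m1 - P.m2) * c =
      b P (k + 1) * (P.m1 * p P c D (k + 1) - P.m2 * q P c D (k + 1) - (P.h1 - P.h2)) +
      a P k * (P.m1 * p P c D k - P.m2 * q P c D k - (P.h1 - P.h2)) := by
  have q1 := hq (P := P) (c := c) (D := D) (k := k + 1) hk
  have q0 := hq (P := P) (c := c) (D := D) (k := k) (by omega)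
  have p1 := hpq (P := P) (c := c) (D := D) (k := k + 1) hk
  have p0 := hpq (P := P) (c := c) (D := D) (k := k) (by omega)
  have e1 : P.m1 * P.m2 * dl P = P.h1 * P.m2 - P.h2 * P.m1 := by
    have := P.m1p
    have := P.m2p
    unfold dl; field_simp
  unfold d at q0 q1
  rw [b_hi P hK] at q0
  rw [b_hi P (k := k + 1) (by omega)] at q1
  rw [b_hi P (k := k + 1) (by omega), p0, p1]
  unfold a cost at *
  push_cast at *
  linear_combination P.m2 * q1 - P.m1 * q0 - P.C * e1

lemma step_I2 (hc : 0 < c) (hI : Inv P c D) {D' : ℕ → ℝ} (hD : Step P c D D')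
    (hc' : Conv P.C D') : P.m2 ≤ P.m1 → ∀ k, P.K < k → k ≤ P.C → Wf P.C D' k ≤ 0 →
    P.h1 - P.h2 ≤ P.m1 * p P (c + P.h0) D' k - P.m2 * q P (c + P.h0) D' k := by
  intro hm k hk1 hk hW
  have hn := (D_le_W hc' (by omega) hk).trans hW
  obtain ⟨l1, l2⟩ := L2 hm hI hD hk1 hk hn
  have hd := d_pos P hk
  have m1p := P.m1p
  have h0p := P.h0p
  refine sub_nonneg.1 (nonneg_of_mul hd ?_)
  have e : cost P (c + P.h0) k = cost P c k + P.h0 := by unfold cost; ring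
  have t := mul_nonneg (sub_nonneg.2 hm) h0p.le
  rcases hW.eq_or_lt with hW | hW
  · have h1 := hpq' (P := P) (c := c + P.h0) (D := D') (k := k) hk
    rw [hW, e] at h1
    linarith
  · obtain ⟨h3, h4⟩ := W_neg hc' hW
    have l3 := (L2 hm hI hD (k := k + 1) (by omega) h3 (h4 ▸ hW.le)).1
    rw [hR hk1.le hk, h4, hD k h3]
    have h5 := hZ (P := P) (c := c) (D := D) hk1.le h3
    have t1 := mul_nonneg (a_nonneg P k) (sub_nonneg.2 l1)
    have t2 := mul_nonneg (b_nonneg P (k := k + 1) h3) (sub_nonneg.2 l3)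
    linarith

lemma R_nonpos (hI : Inv P c D) (hs : P.m1 < P.m2) {k : ℕ} (hk : P.K ≤ k) (hkC : k + 1 ≤ P.C) :
    P.m1 * p P c D k - P.m2 * q P c D k - (P.h1 - P.h2) ≤ 0 := by
  have dp := d_pos P (k := k) (by omega)
  have hz := hI.Z hs (k + 1) (by omega) hkC
  have hWD := W_le_D hI.conv (k := k) (by omega)
  have hR' := hR (P := P) (c := c) (D := D) hk (by omega)
  have h5 : (P.C : ℝ) * P.m1 * P.m2 * (Wf P.C D k - dl P) ≤
      P.C * P.m1 * P.m2 * (D (k + 1) - dl P) := by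
    have := P.m1p
    have := P.m2p
    gcongr
  by_contra hcon
  push Not at hcon
  have := mul_pos dp hcon
  linarith

lemma step_Z (hI : Inv P c D) {D' : ℕ → ℝ} (hD : Step P c D D') :
    P.m1 < P.m2 → ∀ k, P.K < k → k ≤ P.C →
    P.C * P.m1 * P.m2 * (D' k - dl P) + (P.m1 - P.m2) * (c + P.h0) ≤ 0 := by
  intro hs k hk1 hk
  obtain ⟨j, rfl⟩ : ∃ j, k = j + 1 := ⟨k - 1, by omega⟩
  rw [hD j hk]
  have h5 := hZ (P := P) (c := c) (D := D) (k := j) (by omega) hk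
  have t1 := mul_nonneg (a_nonneg P j)
    (neg_nonneg.2 (R_nonpos hI hs (k := j) (by omega) hk))
  have t3 := mul_nonneg (sub_nonneg.2 hs.le) P.h0p.le
  have t2 : b P (j + 1) *
      (P.m1 * p P c D (j + 1) - P.m2 * q P c D (j + 1) - (P.h1 - P.h2)) ≤ 0 := by
    rcases hk.eq_or_lt with h | h
    · have : b P (j + 1) = 0 := by rw [b_hi P (by omega), h]; ring
      rw [this]; simp
    · have := mul_nonneg (b_nonneg P hk)
        (neg_nonneg.2 (R_nonpos hI hs (k := j + 1) (by omega) h))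
      linarith
  linarith

lemma step_Q (hc : 0 < c) (hI : Inv P c D) {D' : ℕ → ℝ} (hD : Step P c D D')
    (hc' : Conv P.C D') : ∀ k, k + 1 ≤ P.C → (k + 1 ≤ P.K ∨ P.m2 ≤ P.m1) →
    q P (c + P.h0) D' (k + 1) ≤ q P (c + P.h0) D' k := by
  intro k hk hor
  rcases le_or_gt (D' (k + 1)) 0 with hn | hpos
  · have hW := D_nonpos (C := P.C) (k := k + 1) (by omega) hn
    rcases le_or_gt (k + 1) P.K with h | h
    · exact Q_of_lo hc' h (step_I1 hc hI hD hc' (k + 1) (by omega) hk hW)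
    · exact Q_of_hi hc' (by omega) hk
        (step_I2 hc hI hD hc' (hor.resolve_left (by omega)) (k + 1) h hk hW)
  · have hW' := D_pos hc' (k := k + 1) (by omega) hk hpos
    have hQ := hI.Q k hk hor
    have p1 := hpq (P := P) (c := c) (D := D) (k := k + 1) hk
    have hDD := hD k hk
    have hle : Wf P.C D' (k + 1) ≤ Wf P.C D (k + 1) := by rw [hW', hDD, p1]; linarith
    have hWp : 0 < Wf P.C D (k + 1) := by rw [hW'] at hle; linarith
    have hDW := (W_pos hI.conv hk hWp).2
    have hW0 : 0 ≤ Wf P.C D k := W_pred_nonneg (by rw [← hDW]; exact hWp.le)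
    have hle0 : Wf P.C D' k ≤ Wf P.C D k := by
      rcases le_or_gt (Wf P.C D' k) 0 with h | h
      · linarith
      · obtain ⟨h1, h2⟩ := W_pos hc' (by omega) h
        obtain ⟨j, rfl⟩ : ∃ j, k = j + 1 := ⟨k - 1, by omega⟩
        have hQ' := hI.Q j (by omega) (by
          rcases hor with h | h
          · exact Or.inl (by omega)
          · exact Or.inr h)
        have p1 := hpq (P := P) (c := c) (D := D) (k := j + 1) (by omega)
        rw [h2, hD j (by omega), p1]; linarith
    have dle : d P k ≤ d P (k + 1) := by
      have := P.m1p
      rcases le_or_gt (k + 1) P.K with h | h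
      · unfold d a; rw [b_lo P h, b_lo P (by omega)]; push_cast; linarith
      · have := hor.resolve_left (by omega)
        unfold d a; rw [b_hi P (by omega), b_hi P (by omega)]; push_cast; linarith
    have d0 := d_pos P (k := k) (by omega)
    have d1 := d_pos P (k := k + 1) hk
    have a1 := hp (P := P) (c := c) (D := D) (k := k + 1) hk
    have a2 := hp (P := P) (c := c + P.h0) (D := D') (k := k + 1) hk
    have a3 := hq (P := P) (c := c) (D := D) (k := k) (by omega)
    have a4 := hq (P := P) (c := c + P.h0) (D := D') (k := k) (by omega)
    have a5 := hpq (P := P) (c := c + P.h0) (D := D') (k := k + 1) hk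
    have e : ∀ k, cost P (c + P.h0) k = cost P c k + P.h0 := by intro k; unfold cost; ring
    rw [e] at a2 a4
    have t1 := mul_nonneg (b_nonneg P hk) (sub_nonneg.2 hle)
    have t2 := mul_nonneg (a_nonneg P k) (sub_nonneg.2 hle0)
    have u1 : p P (c + P.h0) D' (k + 1) - p P c D (k + 1) ≤ P.h0 / d P (k + 1) := by
      rw [le_div_iff₀ d1]; linarith
    have u2 : P.h0 / d P k ≤ q P (c + P.h0) D' k - q P c D k := by
      rw [div_le_iff₀ d0]; linarith
    have u3 : P.h0 / d P (k + 1) ≤ P.h0 / d P k :=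
      div_le_div_of_nonneg_left P.h0p.le d0 dle
    rw [hW', hDD] at a5
    linarith

lemma step_inv (hc : 0 < c) (hI : Inv P c D) {D' : ℕ → ℝ} (hD : Step P c D D') :
    Inv P (c + P.h0) D' := by
  have hc' := step_conv hI hD
  exact ⟨hc', step_pn hc hI hD hc', step_qn hc hI hD hc', step_I1 hc hI hD hc',
    step_I2 hc hI hD hc', step_Z hI hD, step_Q hc hI hD hc'⟩

def Base (P : Par) (D : ℕ → ℝ) : Prop :=
  ∀ k, k + 1 ≤ P.C → D (k + 1) = P.h1 / P.m1 - ((P.C : ℝ) - k) * P.h2 / b P k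

lemma b_pos {k : ℕ} (hk : k + 1 ≤ P.C) : 0 < b P k := by
  have h1 : (k : ℝ) + 1 ≤ P.C := by exact_mod_cast hk
  have h2 : (P.K : ℝ) < P.C := by exact_mod_cast P.hKC
  unfold b
  exact mul_pos (lt_min (by linarith) (by linarith)) P.m2p

lemma base_hi (hB : Base P D) {k : ℕ} (hK : P.K ≤ k) (hk : k + 1 ≤ P.C) : D (k + 1) = dl P := by
  have h1 : (k : ℝ) + 1 ≤ P.C := by exact_mod_cast hk
  have h2 : (0 : ℝ) < (P.C : ℝ) - k := by linarith
  have := P.m2p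
  rw [hB k hk, b_hi P hK]
  unfold dl
  field_simp

lemma base_conv (hB : Base P D) : Conv P.C D := by
  intro k hk1 hk
  obtain ⟨j, rfl⟩ : ∃ j, k = j + 1 := ⟨k - 1, by omega⟩
  rcases le_or_gt P.K j with h | h
  · rw [base_hi hB h (by omega), base_hi hB (by omega) (by omega)]
  · have hb := b_pos (P := P) (k := j) (by omega)
    have := P.h2p
    rw [hB j (by omega), hB (j + 1) (by omega)]
    have : b P (j + 1) = b P j := by rw [b_lo P (by omega), b_lo P (by omega)]
    rw [this]
    push_cast
    gcongr
    linarith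

lemma base_I1 (hB : Base P D) {k : ℕ} (hk : k + 1 ≤ P.C) :
    P.h1 - P.h2 ≤ P.m1 * p P P.h0 D (k + 1) := by
  have hb := b_pos (P := P) (k := k) (by omega)
  have hba := b_anti P k
  have hb1 := b_nonneg P hk
  have m1p := P.m1p
  have h2p := P.h2p
  have h0p := P.h0p
  have hd := d_pos P hk
  have hDW := D_le_W (base_conv hB) (k := k + 1) (by omega) hk
  rw [hB k hk] at hDW
  have h1 := hp (P := P) (c := P.h0) (D := D) (k := k + 1) hk
  have t1 := mul_le_mul_of_nonneg_left hDW hb1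
  have hCk : (0 : ℝ) ≤ (P.C : ℝ) - k := by
    have : (k : ℝ) + 1 ≤ P.C := by exact_mod_cast hk
    linarith
  have t2 : b P (k + 1) * (((P.C : ℝ) - k) * P.h2 / b P k) ≤ ((P.C : ℝ) - k) * P.h2 := by
    rw [mul_div_assoc', div_le_iff₀ hb, mul_comm]
    exact mul_le_mul_of_nonneg_left hba (by positivity)
  have t3 : P.m1 * (d P (k + 1) * p P P.h0 D (k + 1)) =
      P.m1 * (cost P P.h0 (k + 1) + b P (k + 1) * Wf P.C D (k + 1)) := by rw [h1]
  have t4 := mul_le_mul_of_nonneg_left t1 m1p.le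
  have t5 := mul_le_mul_of_nonneg_left t2 m1p.le
  have e1 : P.m1 * (b P (k + 1) * (P.h1 / P.m1)) = b P (k + 1) * P.h1 := by field_simp
  have e2 : P.m1 * cost P P.h0 (k + 1) = P.m1 * P.h0 + a P (k + 1) * P.h1 +
      P.m1 * (((P.C : ℝ) - k) * P.h2) - P.m1 * P.h2 := by
    unfold cost a; push_cast; ring
  have e3 : d P (k + 1) * P.h1 = a P (k + 1) * P.h1 + b P (k + 1) * P.h1 := by unfold d; ring
  have t6 : P.m1 ≤ d P (k + 1) := by
    have : (0 : ℝ) ≤ k * P.m1 := by positivity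
    unfold d a; push_cast; linarith
  have t7 := mul_le_mul_of_nonneg_right t6 h2p.le
  have t8 := mul_pos m1p h0p
  refine sub_nonneg.1 (nonneg_of_mul hd ?_)
  linarith

lemma base_I2 (hB : Base P D) (hm : P.m2 ≤ P.m1) {k : ℕ} (hK : P.K ≤ k) (hk : k + 1 ≤ P.C) :
    P.h1 - P.h2 ≤ P.m1 * p P P.h0 D (k + 1) - P.m2 * q P P.h0 D (k + 1) := by
  have hDW := D_le_W (base_conv hB) (k := k + 1) (by omega) hk
  rw [base_hi hB hK hk] at hDW
  refine sub_nonneg.1 (nonneg_of_mul (d_pos P hk) ?_)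
  rw [hR (by omega) hk]
  have := P.m1p
  have := P.m2p
  have := mul_nonneg (sub_nonneg.2 hm) P.h0p.le
  have : 0 ≤ (P.C : ℝ) * P.m1 * P.m2 * (Wf P.C D (k + 1) - dl P) :=
    mul_nonneg (by positivity) (by linarith)
  linarith

lemma base_inv (hB : Base P D) : Inv P P.h0 D := by
  have hc := base_conv hB
  have m1p := P.m1p
  have m2p := P.m2p
  have h0p := P.h0p
  have h1p := P.h1p
  have h2p := P.h2p
  refine ⟨hc, ?_, ?_, ?_, ?_, ?_, ?_⟩
  · intro k hk
    refine nonneg_of_mul (d_pos P hk) ?_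
    rw [hp hk]
    rcases le_or_gt 0 (Wf P.C D k) with hW | hW
    · have := cost_pos P (c := P.h0) h0p hk
      have := mul_nonneg (b_nonneg P hk) hW
      linarith
    · obtain ⟨h3, h4⟩ := W_neg hc hW
      have hb := b_pos (P := P) h3
      rw [h4, hB k h3]
      have : b P k * (P.h1 / P.m1 - ((P.C : ℝ) - k) * P.h2 / b P k) =
        b P k * (P.h1 / P.m1) - ((P.C : ℝ) - k) * P.h2 := by field_simp
      rw [this]
      unfold cost
      have : 0 ≤ b P k * (P.h1 / P.m1) := by positivity
      have : 0 ≤ (k : ℝ) * P.h1 := by positivity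
      linarith
  · intro k hk
    refine nonneg_of_mul (d_pos P hk) ?_
    rw [hq hk]
    have hCk : (0 : ℝ) ≤ (P.C : ℝ) - k := by
      have : (k : ℝ) ≤ P.C := by exact_mod_cast hk
      linarith
    rcases le_or_gt (Wf P.C D k) 0 with hW | hW
    · have := cost_pos P (c := P.h0) h0p hk
      have := mul_nonneg (a_nonneg P k) (neg_nonneg.2 hW)
      linarith
    · obtain ⟨h3, h4⟩ := W_pos hc hk hW
      obtain ⟨j, rfl⟩ : ∃ j, k = j + 1 := ⟨k - 1, by omega⟩
      have hb := b_pos (P := P) hk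
      have hDle : D (j + 1) ≤ P.h1 / P.m1 := by
        rw [hB j hk]
        have : 0 ≤ ((P.C : ℝ) - j) * P.h2 / b P j := by
          have : (0 : ℝ) ≤ (P.C : ℝ) - j := by push_cast at hCk; linarith
          positivity
        linarith
      have t := mul_le_mul_of_nonneg_left hDle (a_nonneg P (j + 1))
      have e : a P (j + 1) * (P.h1 / P.m1) = ((j + 1 : ℕ) : ℝ) * P.h1 := by
        unfold a; field_simp
      rw [h4]
      unfold cost
      have := mul_nonneg hCk h2p.le
      linarith
  · intro k hk1 hk _
    obtain ⟨j, rfl⟩ : ∃ j, k = j + 1 := ⟨k - 1, by omega⟩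
    exact base_I1 hB hk
  · intro hm k hk1 hk _
    obtain ⟨j, rfl⟩ : ∃ j, k = j + 1 := ⟨k - 1, by omega⟩
    exact base_I2 hB hm (by omega) hk
  · intro hm k hk1 hk
    obtain ⟨j, rfl⟩ : ∃ j, k = j + 1 := ⟨k - 1, by omega⟩
    rw [base_hi hB (by omega) hk]
    have := mul_nonneg (sub_nonneg.2 hm.le) h0p.le
    linarith
  · intro k hk hor
    rcases le_or_gt (k + 1) P.K with h | h
    · exact Q_of_lo hc h (base_I1 hB hk)
    · exact Q_of_hi hc (by omega) hk (base_I2 hB (hor.resolve_left (by omega)) (by omega) hk)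

end Clearing


namespace Clearing

/-- The cost-to-clear of `ℓ` slow customers. -/
noncomputable def gfun (C₂ : ℕ) (μ₂ h₂ : ℝ) (ℓ : ℕ) : ℝ :=
  ∑ j ∈ Finset.range ℓ, ((j : ℝ) + 1) * h₂ / (((min (j + 1) C₂ : ℕ) : ℝ) * μ₂)

lemma v_zero {C₁ C₂ : ℕ} (hC₂pos : 1 ≤ C₂)
    {μ₁ μ₂ h₀ h₁ h₂ : ℝ} (hμ₁ : 0 < μ₁) (hμ₂ : 0 < μ₂)
    {v : ℕ → ℕ → ℕ → ℝ} (hv : IsValue C₁ C₂ μ₁ μ₂ h₀ h₁ h₂ v) :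
    ∀ n k ℓ : ℕ, k + ℓ = n → n ≤ C₁ → v 0 k ℓ = k * (h₁ / μ₁) + gfun C₂ μ₂ h₂ ℓ := by
  intro n
  induction n with
  | zero =>
    intro k ℓ h _
    obtain ⟨rfl, rfl⟩ : k = 0 ∧ ℓ = 0 := by omega
    rw [hv.1]; simp [gfun]
  | succ n ih =>
    intro k ℓ h hn
    rw [hv.2.1 k ℓ (by omega) (by omega)]
    unfold dRate
    rcases k with _ | k
    · obtain ⟨ℓ, rfl⟩ : ∃ j, ℓ = j + 1 := ⟨ℓ - 1, by omega⟩
      rw [show ℓ + 1 - 1 = ℓ from rfl, ih 0 ℓ (by omega) (by omega)]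
      have hm : (0 : ℝ) < ((min (ℓ + 1) C₂ : ℕ) : ℝ) := by
        exact_mod_cast (by omega : 0 < min (ℓ + 1) C₂)
      simp only [gfun, Finset.sum_range_succ]
      generalize ((min (ℓ + 1) C₂ : ℕ) : ℝ) = m at *
      generalize (∑ j ∈ Finset.range ℓ, ((j : ℝ) + 1) * h₂ / (((min (j + 1) C₂ : ℕ) : ℝ) * μ₂)) = G
      push_cast
      field_simp
      ring
    · rcases ℓ with _ | ℓ
      · rw [show k + 1 - 1 = k from rfl, ih k 0 (by omega) (by omega)]
        have hk : (0 : ℝ) < ((k + 1 : ℕ) : ℝ) := by exact_mod_cast Nat.succ_pos k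
        simp [gfun]
        have : (0 : ℝ) < (k : ℝ) + 1 := by positivity
        field_simp
        ring
      · rw [show k + 1 - 1 = k from rfl, show ℓ + 1 - 1 = ℓ from rfl,
          ih k (ℓ + 1) (by omega) (by omega), ih (k + 1) ℓ (by omega) (by omega)]
        have hm : (0 : ℝ) < ((min (ℓ + 1) C₂ : ℕ) : ℝ) := by
          exact_mod_cast (by omega : 0 < min (ℓ + 1) C₂)
        simp only [gfun, Finset.sum_range_succ]
        generalize ((min (ℓ + 1) C₂ : ℕ) : ℝ) = m at *
        generalize (∑ j ∈ Finset.range ℓ,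
          ((j : ℝ) + 1) * h₂ / (((min (j + 1) C₂ : ℕ) : ℝ) * μ₂)) = G
        have : (0 : ℝ) < ((k : ℝ) + 1) * μ₁ + m * μ₂ := by positivity
        push_cast
        field_simp
        ring

lemma Dv_zero {C₁ C₂ : ℕ} (hC₂pos : 1 ≤ C₂)
    {μ₁ μ₂ h₀ h₁ h₂ : ℝ} (hμ₁ : 0 < μ₁) (hμ₂ : 0 < μ₂)
    {v : ℕ → ℕ → ℕ → ℝ} (hv : IsValue C₁ C₂ μ₁ μ₂ h₀ h₁ h₂ v) (k ℓ : ℕ) (h : k + 1 + ℓ ≤ C₁) :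
    Dv v 0 (k + 1) ℓ = h₁ / μ₁ - ((ℓ : ℝ) + 1) * h₂ / (((min (ℓ + 1) C₂ : ℕ) : ℝ) * μ₂) := by
  unfold Dv
  rw [v_zero hC₂pos hμ₁ hμ₂ hv _ _ _ rfl h, show k + 1 - 1 = k from rfl,
    v_zero hC₂pos hμ₁ hμ₂ hv _ k (ℓ + 1) rfl (by omega)]
  simp only [gfun, Finset.sum_range_succ]
  push_cast
  ring

lemma b_eq (P : Par) {k : ℕ} (hk : k ≤ P.C) :
    b P k = ((min (P.C - k) (P.C - P.K) : ℕ) : ℝ) * P.m2 := by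
  unfold b
  rw [Nat.cast_min, Nat.cast_sub hk, Nat.cast_sub P.hKC.le]

/-- one-step identities -/
lemma v_step (P : Par) {v : ℕ → ℕ → ℕ → ℝ}
    (hv : IsValue P.C (P.C - P.K) P.m1 P.m2 P.h0 P.h1 P.h2 v) (i : ℕ) :
    Step P (((i : ℝ) + 1) * P.h0) (fun k => Dv v i k (P.C - k))
      (fun k => Dv v (i + 1) k (P.C - k)) := by
  have gen : ∀ k ≤ P.C, v (i + 1) k (P.C - k) =
      cost P (((i : ℝ) + 1) * P.h0) k / d P k
      + a P k / d P k * min (v i k (P.C - k)) (v i (k - 1) (P.C - k + 1))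
      + b P k / d P k * min (v i (k + 1) (P.C - k - 1)) (v i k (P.C - k)) := by
    intro k hk
    rw [hv.2.2 i k (P.C - k) (by omega)]
    have e1 : dRate (P.C - P.K) P.m1 P.m2 k (P.C - k) = d P k := by
      unfold dRate d a; rw [b_eq P hk]
    have e2 : (((i : ℝ) + 1) * P.h0 + (k : ℝ) * P.h1 + ((P.C - k : ℕ) : ℝ) * P.h2) =
        cost P (((i : ℝ) + 1) * P.h0) k := by
      unfold cost; rw [Nat.cast_sub hk]
    rw [e1, e2, b_eq P hk, a]
  have minA : ∀ x y : ℝ, min x y = x - max (x - y) 0 := by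
    intro x y
    rcases le_total x y with h | h
    · rw [min_eq_left h, max_eq_right (by linarith)]; ring
    · rw [min_eq_right h, max_eq_left (by linarith)]; ring
  have minB : ∀ x y : ℝ, min y x = x + min (y - x) 0 := by
    intro x y
    rcases le_total x y with h | h
    · rw [min_eq_right h, min_eq_right (by linarith)]; ring
    · rw [min_eq_left h, min_eq_left (by linarith)]; ring
  intro k hk
  have g1 := gen (k + 1) hk
  have g0 := gen k (by omega)
  have d1 := d_pos P hk
  have d0 := d_pos P (k := k) (by omega)
  have ed1 : d P (k + 1) = a P (k + 1) + b P (k + 1) := rfl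
  have ed0 : d P k = a P k + b P k := rfl
  have s1 : P.C - (k + 1) + 1 = P.C - k := by omega
  have s2 : P.C - k - 1 = P.C - (k + 1) := by omega
  have P1 : v (i + 1) (k + 1) (P.C - (k + 1)) =
      p P (((i : ℝ) + 1) * P.h0) (fun k => Dv v i k (P.C - k)) (k + 1) +
        min (v i (k + 1) (P.C - (k + 1))) (v i k (P.C - k)) := by
    rw [g1, show k + 1 - 1 = k from rfl, s1, p]
    rcases hk.eq_or_lt with h | h
    · have hb : b P (k + 1) = 0 := by rw [b_hi P (by have := P.hKC; omega), h]; ring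
      rw [hb] at ed1 ⊢
      rw [← show d P (k + 1) = a P (k + 1) by linarith]
      field_simp
      ring
    · have hW : Wf P.C (fun k => Dv v i k (P.C - k)) (k + 1) =
          min (v i (k + 1 + 1) (P.C - (k + 1) - 1)) (v i (k + 1) (P.C - (k + 1))) -
          min (v i (k + 1) (P.C - (k + 1))) (v i k (P.C - k)) := by
        unfold Wf
        rw [if_pos (by omega), if_pos h,
          minB (v i (k + 1) (P.C - (k + 1))) (v i (k + 1 + 1) (P.C - (k + 1) - 1)),
          minA (v i (k + 1) (P.C - (k + 1))) (v i k (P.C - k))]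
        unfold Dv
        simp only [Nat.add_sub_cancel]
        rw [s1, show P.C - (k + 1 + 1) + 1 = P.C - (k + 1) by omega,
          show P.C - (k + 1) - 1 = P.C - (k + 1 + 1) by omega]
        ring
      rw [hW]
      field_simp
      rw [ed1]
      ring
  have P0 : v (i + 1) k (P.C - k) =
      q P (((i : ℝ) + 1) * P.h0) (fun k => Dv v i k (P.C - k)) k +
        min (v i (k + 1) (P.C - (k + 1))) (v i k (P.C - k)) := by
    rw [g0, s2, q]
    rcases Nat.eq_zero_or_pos k with h | h
    · have ha : a P k = 0 := by rw [h]; simp [a]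
      rw [ha] at ed0 ⊢
      rw [← show d P k = b P k by linarith]
      field_simp
      ring
    · have hW : Wf P.C (fun k => Dv v i k (P.C - k)) k =
          min (v i (k + 1) (P.C - (k + 1))) (v i k (P.C - k)) -
          min (v i k (P.C - k)) (v i (k - 1) (P.C - k + 1)) := by
        unfold Wf
        rw [if_pos (show 1 ≤ k from h), if_pos (show k < P.C from hk),
          minB (v i k (P.C - k)) (v i (k + 1) (P.C - (k + 1))),
          minA (v i k (P.C - k)) (v i (k - 1) (P.C - k + 1))]
        unfold Dv
        simp only [Nat.add_sub_cancel]
        rw [s1]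
        ring
      rw [hW]
      field_simp
      rw [ed0]
      ring
  change v (i + 1) (k + 1) (P.C - (k + 1)) - v (i + 1) (k + 1 - 1) (P.C - (k + 1) + 1) = _
  rw [show k + 1 - 1 = k from rfl, s1, P1, P0]
  ring

lemma inv_all (P : Par) {v : ℕ → ℕ → ℕ → ℝ}
    (hv : IsValue P.C (P.C - P.K) P.m1 P.m2 P.h0 P.h1 P.h2 v) (i : ℕ) :
    Inv P (((i : ℝ) + 1) * P.h0) (fun k => Dv v i k (P.C - k)) := by
  have h0p := P.h0p
  have hKC := P.hKC
  induction i with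
  | zero =>
    have : (((0 : ℕ) : ℝ) + 1) * P.h0 = P.h0 := by simp
    rw [this]
    refine base_inv ?_
    intro k hk
    have h := Dv_zero (by omega) P.m1p P.m2p hv k (P.C - (k + 1)) (by omega)
    have s1 : P.C - (k + 1) + 1 = P.C - k := by omega
    have s2 : ((P.C - (k + 1) : ℕ) : ℝ) + 1 = (P.C : ℝ) - k := by
      rw [Nat.cast_sub hk]; push_cast; ring
    rw [s1, s2] at h
    rw [b_eq P (by omega)]
    exact h
  | succ i ih =>
    have := step_inv (by positivity) ih (v_step P hv i)
    have e : ((i : ℝ) + 1) * P.h0 + P.h0 = (((i + 1 : ℕ) : ℝ) + 1) * P.h0 := by push_cast; ring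
    rwa [e] at this

end Clearing

theorem stmt7
    (C₁ C₂ : ℕ) (hC₂pos : 1 ≤ C₂) (hC : C₂ < C₁)
    (μ₁ μ₂ h₀ h₁ h₂ : ℝ)
    (hμ₁ : 0 < μ₁) (hμ₂ : 0 < μ₂)
    (hh₀ : 0 < h₀) (hh₁ : 0 < h₁) (hh₂ : 0 < h₂)
    (v : ℕ → ℕ → ℕ → ℝ) (hv : IsValue C₁ C₂ μ₁ μ₂ h₀ h₁ h₂ v)
 :
    ∀ i k ℓ : ℕ, memX C₁ i k ℓ → 1 ≤ k → 1 ≤ ℓ →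
      0 ≤ Dv v i (k + 1) (ℓ - 1) - Dv v i k ℓ := by
  intro i k ℓ hX hk hℓ
  rcases hX with ⟨rfl, hlt⟩ | heq
  · obtain ⟨k, rfl⟩ : ∃ j, k = j + 1 := ⟨k - 1, by omega⟩
    obtain ⟨ℓ, rfl⟩ : ∃ j, ℓ = j + 1 := ⟨ℓ - 1, by omega⟩
    rw [show ℓ + 1 - 1 = ℓ from rfl,
      Clearing.Dv_zero hC₂pos hμ₁ hμ₂ hv (k + 1) ℓ (by omega),
      Clearing.Dv_zero hC₂pos hμ₁ hμ₂ hv k (ℓ + 1) (by omega)]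
    have hm : (0 : ℝ) < ((min (ℓ + 1) C₂ : ℕ) : ℝ) := by
      exact_mod_cast (by omega : 0 < min (ℓ + 1) C₂)
    have hm' : (0 : ℝ) < ((min (ℓ + 1 + 1) C₂ : ℕ) : ℝ) := by
      exact_mod_cast (by omega : 0 < min (ℓ + 1 + 1) C₂)
    have key : ((ℓ : ℝ) + 1) * ((min (ℓ + 1 + 1) C₂ : ℕ) : ℝ) ≤
        (((ℓ + 1 : ℕ) : ℝ) + 1) * ((min (ℓ + 1) C₂ : ℕ) : ℝ) := by
      rcases le_or_gt C₂ (ℓ + 1) with h | h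
      · rw [min_eq_right h, min_eq_right (by omega)]
        push_cast
        gcongr
        linarith
      · rw [min_eq_left h.le, min_eq_left (by omega)]
        push_cast
        linarith
    have : ((ℓ : ℝ) + 1) * h₂ / (((min (ℓ + 1) C₂ : ℕ) : ℝ) * μ₂) ≤
        (((ℓ + 1 : ℕ) : ℝ) + 1) * h₂ / (((min (ℓ + 1 + 1) C₂ : ℕ) : ℝ) * μ₂) := by
      rw [div_le_div_iff₀ (by positivity) (by positivity)]
      have := mul_le_mul_of_nonneg_right key (mul_pos hh₂ hμ₂).le
      linarith
    linarith
  · have e : C₁ - (C₁ - C₂) = C₂ := by omega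
    let P : Clearing.Par := ⟨C₁, C₁ - C₂, μ₁, μ₂, h₀, h₁, h₂, by omega, by omega,
      hμ₁, hμ₂, hh₀, hh₁, hh₂⟩
    have h := (Clearing.inv_all P (v := v) (by
      change IsValue C₁ (C₁ - (C₁ - C₂)) μ₁ μ₂ h₀ h₁ h₂ v
      rw [e]; exact hv) i).conv k hk (by change k < C₁; omega)
    change Dv v i k (C₁ - k) ≤ Dv v i (k + 1) (C₁ - (k + 1)) at h
    rw [show C₁ - k = ℓ by omega, show C₁ - (k + 1) = ℓ - 1 by omega] at h
    linarith
end

section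
/- Let (i,k,ℓ) ∈ X̃_diff with i ≥ 1. If D(i−1,k,ℓ) ≥ 0, then D(i,k,ℓ) = p_k·(i·c_k + b_k) + q_k·max(0, D(i−1,k−1,ℓ+1)) + r_k·D(i−1,k,ℓ), where in the case k = 1 the coefficient q_k is zero and the corresponding term is omitted. -/
/-- `p_k` (with `ℓ = C₁ − k`). -/
noncomputable def pCoef (C₁ C₂ : ℕ) (μ₁ μ₂ : ℝ) (k ℓ : ℕ) : ℝ :=
  (if ℓ < C₂ then (C₁ : ℝ) else (C₂ : ℝ)) * μ₁ * μ₂ /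
    (dRate C₂ μ₁ μ₂ k ℓ * dRate C₂ μ₁ μ₂ (k - 1) (ℓ + 1))

/-- `q_k = (k−1)·μ₁ / d(k−1,ℓ+1)`. -/
noncomputable def qCoef (C₂ : ℕ) (μ₁ μ₂ : ℝ) (k ℓ : ℕ) : ℝ :=
  ((k - 1 : ℕ) : ℝ) * μ₁ / dRate C₂ μ₁ μ₂ (k - 1) (ℓ + 1)

/-- `r_k = min(ℓ,C₂)·μ₂ / d(k,ℓ)`. -/
noncomputable def rCoef (C₂ : ℕ) (μ₁ μ₂ : ℝ) (k ℓ : ℕ) : ℝ :=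
  ((min ℓ C₂ : ℕ) : ℝ) * μ₂ / dRate C₂ μ₁ μ₂ k ℓ

/-- `b_k` : equals `b` if `ℓ < C₂` and `b′` otherwise. -/
noncomputable def bCoef (C₁ C₂ : ℕ) (μ₁ μ₂ h₁ h₂ : ℝ) (ℓ : ℕ) : ℝ :=
  if ℓ < C₂ then h₁ / μ₁ - h₂ / μ₂
  else (h₁ - h₂) / μ₁ - (C₁ : ℝ) * h₂ / ((C₂ : ℝ) * μ₂)

/-- `c_k` : equals `c` if `ℓ < C₂` and `c′` otherwise. -/
noncomputable def cCoef (C₁ C₂ : ℕ) (μ₁ μ₂ h₀ : ℝ) (ℓ : ℕ) : ℝ :=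
  if ℓ < C₂ then h₀ / (C₁ : ℝ) * (1 / μ₁ - 1 / μ₂)
  else -h₀ / ((C₂ : ℝ) * μ₂)


/-- The combined one-step quantity built from differences. -/
noncomputable def Fq (E : ℕ → ℕ → ℝ) (i l : ℕ) : ℝ :=
  max (E i l) 0 - max (-(E i (l - 1))) 0

/-- The per-stage reward `i c_k + b_k`. -/
noncomputable def Gq (C₂ : ℕ) (b c bb cc : ℝ) (i l : ℕ) : ℝ :=
  if l < C₂ then (i : ℝ) * c + b else (i : ℝ) * cc + bb

/-- Differences are non-increasing in `l`. -/
def AntiE (N : ℕ) (E : ℕ → ℕ → ℝ) (i : ℕ) : Prop :=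
  ∀ l, 1 ≤ l → l ≤ N → E i l ≤ E i (l - 1)

/-- The one-step recursion for the differences. -/
def RecE (N C₂ : ℕ) (a : ℕ → ℝ) (b c b' c' : ℝ) (E : ℕ → ℕ → ℝ) : Prop :=
  ∀ i l, l < N → E (i + 1) l = (a (l + 1) - a l) * Gq C₂ b c b' c' (i + 1) l
    + a l * Fq E i l + (1 - a (l + 1)) * Fq E i (l + 1)

theorem AntiE.pred {N : ℕ} {E : ℕ → ℕ → ℝ} {i : ℕ} (h : AntiE N E i) (l : ℕ) (hl : l ≤ N) :
    E i l ≤ E i (l - 1) := by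
  rcases Nat.eq_zero_or_pos l with rfl | h0
  · simp
  · exact h l h0 hl

theorem Fq_ge {N : ℕ} {E : ℕ → ℕ → ℝ} {i : ℕ} (h : AntiE N E i) (l : ℕ) (hl : l ≤ N) :
    E i l ≤ Fq E i l := by
  have := h.pred l hl
  unfold Fq
  rcases max_cases (E i l) 0 with h1 | h1 <;>
    rcases max_cases (-(E i (l - 1))) 0 with h2 | h2 <;> linarith

theorem Fq_le {N : ℕ} {E : ℕ → ℕ → ℝ} {i : ℕ} (h : AntiE N E i) (l : ℕ) (hl : l ≤ N) :
    Fq E i l ≤ E i (l - 1) := by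
  have := h.pred l hl
  unfold Fq
  rcases max_cases (E i l) 0 with h1 | h1 <;>
    rcases max_cases (-(E i (l - 1))) 0 with h2 | h2 <;> linarith

theorem Fq_anti {N : ℕ} {E : ℕ → ℕ → ℝ} {i : ℕ} (h : AntiE N E i) (l : ℕ) (hl : l + 1 ≤ N) :
    Fq E i (l + 1) ≤ Fq E i l :=
  (Fq_le h (l + 1) hl).trans (by simpa using Fq_ge h l (by omega))

/-- One step of the monotonicity induction. -/
theorem anti_step {N C₂ : ℕ} {a : ℕ → ℝ} {b c b' c' : ℝ} {E : ℕ → ℕ → ℝ}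
    (hN : 1 ≤ N)
    (hE : ∀ i, E i N = E i (N - 1))
    (ha0 : ∀ l, l ≤ N → 0 ≤ a l) (ha1 : ∀ l, l ≤ N → a l ≤ 1)
    (hrec : RecE N C₂ a b c b' c' E) {i : ℕ} (h : AntiE N E i)
    (hX : ∀ l, l + 1 < N →
      (a (l + 1) - a l) * (Fq E i (l + 1) - Gq C₂ b c b' c' (i + 1) l)
      + (a (l + 2) - a (l + 1)) * (Gq C₂ b c b' c' (i + 1) (l + 1) - Fq E i (l + 1))
      ≤ (1 - a (l + 2)) * (Fq E i (l + 1) - Fq E i (l + 2))) :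
    AntiE N E (i + 1) := by
  intro l h1 hl
  obtain ⟨m, rfl⟩ : ∃ m, l = m + 1 := ⟨l - 1, by omega⟩
  rcases Nat.lt_or_ge (m + 1) N with h2 | h2
  · have e1 := hrec i (m + 1) h2
    have e2 := hrec i m (by omega)
    have h3 := hX m h2
    have h4 := mul_nonneg (ha0 m (by omega)) (sub_nonneg.2 (Fq_anti h m hl))
    simp only [Nat.add_sub_cancel]
    rw [e1, e2]
    simp only [add_assoc, Nat.reduceAdd] at *
    linarith
  · have : m + 1 = N := by omega
    rw [this, hE]

/-- Lower bound by a convex combination. -/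
theorem rec_ge {N C₂ : ℕ} {a : ℕ → ℝ} {b c b' c' : ℝ} {E : ℕ → ℕ → ℝ}
    (ha0 : ∀ l, l ≤ N → 0 ≤ a l) (ha1 : ∀ l, l ≤ N → a l ≤ 1)
    (hinc : ∀ l, l < N → a l ≤ a (l + 1))
    (hrec : RecE N C₂ a b c b' c' E) {i l : ℕ} (hl : l < N) (x : ℝ)
    (h1 : x ≤ Gq C₂ b c b' c' (i + 1) l) (h2 : x ≤ Fq E i l) (h3 : x ≤ Fq E i (l + 1)) :
    x ≤ E (i + 1) l := by
  rw [hrec i l hl]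
  have := mul_nonneg (sub_nonneg.2 (hinc l hl)) (sub_nonneg.2 h1)
  have := mul_nonneg (ha0 l hl.le) (sub_nonneg.2 h2)
  have := mul_nonneg (sub_nonneg.2 (ha1 (l + 1) hl)) (sub_nonneg.2 h3)
  linarith

theorem rec_le {N C₂ : ℕ} {a : ℕ → ℝ} {b c b' c' : ℝ} {E : ℕ → ℕ → ℝ}
    (ha0 : ∀ l, l ≤ N → 0 ≤ a l) (ha1 : ∀ l, l ≤ N → a l ≤ 1)
    (hinc : ∀ l, l < N → a l ≤ a (l + 1))
    (hrec : RecE N C₂ a b c b' c' E) {i l : ℕ} (hl : l < N) (x : ℝ)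
    (h1 : Gq C₂ b c b' c' (i + 1) l ≤ x) (h2 : Fq E i l ≤ x) (h3 : Fq E i (l + 1) ≤ x) :
    E (i + 1) l ≤ x := by
  rw [hrec i l hl]
  have := mul_nonneg (sub_nonneg.2 (hinc l hl)) (sub_nonneg.2 h1)
  have := mul_nonneg (ha0 l hl.le) (sub_nonneg.2 h2)
  have := mul_nonneg (sub_nonneg.2 (ha1 (l + 1) hl)) (sub_nonneg.2 h3)
  linarith

/-- Monotonicity when `c ≥ 0`. -/
theorem anti_pos {N C₂ : ℕ} {a : ℕ → ℝ} {b c b' c' : ℝ} {E : ℕ → ℕ → ℝ}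
    (hC2 : 1 ≤ C₂) (hC : C₂ < N)
    (hE : ∀ i, E i N = E i (N - 1))
    (ha0 : ∀ l, l ≤ N → 0 ≤ a l) (ha1 : ∀ l, l ≤ N → a l ≤ 1)
    (hinc : ∀ l, l < N → a l ≤ a (l + 1))
    (hconv : ∀ l, C₂ ≤ l → l + 1 < N → a (l + 1) - a l ≤ a (l + 2) - a (l + 1))
    (hconc : ∀ l, l + 1 < C₂ → a (l + 2) - a (l + 1) ≤ a (l + 1) - a l)
    (hrec : RecE N C₂ a b c b' c' E)
    (hc : 0 ≤ c) (hc' : c' ≤ 0) (hbb : b' ≤ b)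
    (hanti0 : AntiE N E 0) (hE0 : ∀ l, l < N → b' ≤ E 0 l ∧ E 0 l ≤ b) (i : ℕ) :
    AntiE N E i ∧ ∀ l, l < N → (i : ℝ) * c' + b' ≤ E i l ∧ E i l ≤ (i : ℝ) * c + b := by
  induction i with
  | zero => exact ⟨hanti0, by simpa using hE0⟩
  | succ i ih =>
    obtain ⟨hA, hB⟩ := ih
    have hB' : ∀ l, l ≤ N → (i : ℝ) * c' + b' ≤ E i l ∧ E i l ≤ (i : ℝ) * c + b := by
      intro l hl
      rcases Nat.lt_or_ge l N with h | h
      · exact hB l h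
      · have : l = N := by omega
        rw [this, hE]; exact hB _ (by omega)
    have hi : (0 : ℝ) ≤ i := Nat.cast_nonneg i
    have hgg : ((i : ℝ) + 1) * c' + b' ≤ ((i : ℝ) + 1) * c + b := by nlinarith
    have hF : ∀ l, l ≤ N → ((i : ℝ) + 1) * c' + b' ≤ Fq E i l ∧
        Fq E i l ≤ ((i : ℝ) + 1) * c + b := by
      intro l hl
      have h1 := Fq_ge hA l hl
      have h2 := Fq_le hA l hl
      have h3 := hB' l hl
      have h4 := hB' (l - 1) (by omega)
      constructor <;> linarith
    have hG : ∀ l, ((i : ℝ) + 1) * c' + b' ≤ Gq C₂ b c b' c' (i + 1) l ∧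
        Gq C₂ b c b' c' (i + 1) l ≤ ((i : ℝ) + 1) * c + b := by
      intro l
      unfold Gq
      push_cast
      split_ifs <;> constructor <;> linarith
    refine ⟨anti_step (by omega) hE ha0 ha1 hrec hA ?_, ?_⟩
    · intro l hl
      have hr : 0 ≤ (1 - a (l + 2)) * (Fq E i (l + 1) - Fq E i (l + 2)) :=
        mul_nonneg (sub_nonneg.2 (ha1 _ hl)) (sub_nonneg.2 (Fq_anti hA (l + 1) hl))
      refine le_trans ?_ hr
      have hf := hF (l + 1) hl.le
      have i1 := hinc l (by omega)
      have i2 := hinc (l + 1) (by omega)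
      unfold Gq
      push_cast
      rcases lt_trichotomy (l + 1) C₂ with h | h | h
      · rw [if_pos (by omega), if_pos h]
        have := hconc l h
        nlinarith [mul_nonneg (sub_nonneg.2 this) (sub_nonneg.2 hf.2)]
      · rw [if_pos (by omega), if_neg (by omega)]
        nlinarith [mul_nonneg (sub_nonneg.2 i1) (sub_nonneg.2 hf.2),
          mul_nonneg (sub_nonneg.2 i2) (sub_nonneg.2 hf.1)]
      · rw [if_neg (by omega), if_neg (by omega)]
        have := hconv l (by omega) hl
        nlinarith [mul_nonneg (sub_nonneg.2 this) (sub_nonneg.2 hf.1)]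
    · intro l hl
      push_cast
      exact ⟨rec_ge ha0 ha1 hinc hrec hl _ (hG l).1 (hF l hl.le).1 (hF (l + 1) hl).1,
        rec_le ha0 ha1 hinc hrec hl _ (hG l).2 (hF l hl.le).2 (hF (l + 1) hl).2⟩

/-- Monotonicity when `c ≤ 0`. -/
theorem anti_neg {N C₂ : ℕ} {a : ℕ → ℝ} {b c b' c' : ℝ} {E : ℕ → ℕ → ℝ}
    (hC2 : 1 ≤ C₂) (hC : C₂ < N)
    (hE : ∀ i, E i N = E i (N - 1))
    (ha0 : ∀ l, l ≤ N → 0 ≤ a l) (ha1 : ∀ l, l ≤ N → a l ≤ 1)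
    (hinc : ∀ l, l < N → a l ≤ a (l + 1))
    (hconv : ∀ l, C₂ ≤ l → l + 1 < N → a (l + 1) - a l ≤ a (l + 2) - a (l + 1))
    (hconv' : ∀ l, l + 1 < C₂ → a (l + 1) - a l ≤ a (l + 2) - a (l + 1))
    (hmid : ∀ (i : ℕ) (x : ℝ), (i : ℝ) * c' + b' ≤ x → x ≤ b →
      (a C₂ - a (C₂ - 1)) * (x - (i * c + b)) + (a (C₂ + 1) - a C₂) * ((i * c' + b') - x) ≤ 0)
    (hrec : RecE N C₂ a b c b' c' E)
    (hc : c ≤ 0) (hc' : c' ≤ c) (hbb : b' ≤ b)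
    (hanti0 : AntiE N E 0) (hE0 : ∀ l, l < N → b' ≤ E 0 l ∧ E 0 l ≤ b)
    (hE0' : ∀ l, l < C₂ → E 0 l = b) (i : ℕ) :
    AntiE N E i ∧ (∀ l, l < N → (i : ℝ) * c' + b' ≤ E i l ∧ E i l ≤ b)
      ∧ (∀ l, l < C₂ → min 0 ((i : ℝ) * c + b) ≤ E i l)
      ∧ (0 ≤ ((i : ℝ) + 1) * c + b → ∀ l, l < C₂ →
        (1 - a l) * ((((i : ℝ) + 1) * c + b) - Fq E i l) ≤
        (1 - a (l + 1)) * ((((i : ℝ) + 1) * c + b) - Fq E i (l + 1))) := by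
  induction i with
  | zero =>
    refine ⟨hanti0, by simpa using hE0, ?_, ?_⟩
    · intro l hl; rw [hE0' l hl]; simp
    · intro hg l hl
      simp only [Nat.cast_zero, zero_add, one_mul] at hg ⊢
      have hb : 0 ≤ b := by linarith
      have hF : ∀ m, m < C₂ → Fq E 0 m = b := by
        intro m hm
        unfold Fq
        rw [hE0' m hm, hE0' (m - 1) (by omega), max_eq_left hb, max_eq_right (by linarith)]
        ring
      have hF' : Fq E 0 (l + 1) ≤ b := by
        have := Fq_le hanti0 (l + 1) (by omega)
        simp only [Nat.add_sub_cancel] at this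
        rwa [hE0' l hl] at this
      rw [hF l hl]
      have h1 := mul_nonneg (sub_nonneg.2 (ha1 (l + 1) (by omega))) (sub_nonneg.2 hF')
      have h2 := mul_nonneg (sub_nonneg.2 (hinc l (by omega))) (neg_nonneg.2 hc)
      nlinarith
  | succ i ih =>
    obtain ⟨hA, hB, hL, hK⟩ := ih
    have hB' : ∀ l, l ≤ N → (i : ℝ) * c' + b' ≤ E i l ∧ E i l ≤ b := by
      intro l hl
      rcases Nat.lt_or_ge l N with h | h
      · exact hB l h
      · have : l = N := by omega
        rw [this, hE]; exact hB _ (by omega)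
    have hi : (0 : ℝ) ≤ i := Nat.cast_nonneg i
    have hgg : ((i : ℝ) + 1) * c' + b' ≤ ((i : ℝ) + 1) * c + b := by nlinarith
    have hgb : ((i : ℝ) + 1) * c + b ≤ b := by nlinarith
    have hF : ∀ l, l ≤ N → ((i : ℝ) + 1) * c' + b' ≤ Fq E i l ∧ Fq E i l ≤ b := by
      intro l hl
      have h1 := Fq_ge hA l hl
      have h2 := Fq_le hA l hl
      have h3 := hB' l hl
      have h4 := hB' (l - 1) (by omega)
      constructor <;> linarith
    have hG : ∀ l, ((i : ℝ) + 1) * c' + b' ≤ Gq C₂ b c b' c' (i + 1) l ∧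
        Gq C₂ b c b' c' (i + 1) l ≤ b := by
      intro l
      unfold Gq
      push_cast
      split_ifs <;> constructor <;> linarith
    have hmin : min 0 (((i : ℝ) + 1) * c + b) ≤ min 0 ((i : ℝ) * c + b) :=
      min_le_min le_rfl (by linarith)
    have hFL : ∀ l, l ≤ C₂ → min 0 (((i : ℝ) + 1) * c + b) ≤ Fq E i l := by
      intro l hl
      rcases Nat.lt_or_ge l C₂ with h | h
      · exact (hmin.trans (hL l h)).trans (Fq_ge hA l (by omega))
      · have h1 := hmin.trans (hL (l - 1) (by omega))
        have h0 : min 0 (((i : ℝ) + 1) * c + b) ≤ 0 := min_le_left _ _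
        unfold Fq
        have := le_max_right (E i l) 0
        rcases max_cases (-(E i (l - 1))) 0 with h2 | h2 <;> linarith
    have hL1 : ∀ l, l < C₂ → min 0 (((i : ℝ) + 1) * c + b) ≤ E (i + 1) l := by
      intro l hl
      refine rec_ge ha0 ha1 hinc hrec (by omega) _ ?_ (hFL l hl.le) (hFL (l + 1) hl)
      unfold Gq
      rw [if_pos hl]; push_cast; exact min_le_right _ _
    refine ⟨anti_step (by omega) hE ha0 ha1 hrec hA ?_, ?_, ?_, ?_⟩
    · intro l hl
      have hr : 0 ≤ (1 - a (l + 2)) * (Fq E i (l + 1) - Fq E i (l + 2)) :=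
        mul_nonneg (sub_nonneg.2 (ha1 _ hl)) (sub_nonneg.2 (Fq_anti hA (l + 1) hl))
      have hf := hF (l + 1) hl.le
      have i1 := hinc l (by omega)
      have i2 := hinc (l + 1) (by omega)
      unfold Gq
      push_cast
      rcases lt_trichotomy (l + 1) C₂ with h | h | h
      · rw [if_pos (by omega), if_pos h]
        have hcv := hconv' l h
        rcases le_total (((i : ℝ) + 1) * c + b) (Fq E i (l + 1)) with hx | hx
        · refine le_trans ?_ hr
          nlinarith [mul_nonneg (sub_nonneg.2 hcv) (sub_nonneg.2 hx)]
        · rcases le_total 0 (((i : ℝ) + 1) * c + b) with hg | hg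
          · have hk := hK hg (l + 1) h
            simp only [add_assoc, Nat.reduceAdd] at hk ⊢
            nlinarith [mul_nonneg (sub_nonneg.2 i1) (sub_nonneg.2 hx)]
          · have h5 := hFL (l + 1) h.le
            rw [min_eq_right hg] at h5
            refine le_trans ?_ hr
            nlinarith [mul_nonneg (sub_nonneg.2 hcv) (sub_nonneg.2 h5)]
      · rw [if_pos (by omega), if_neg (by omega)]
        refine le_trans ?_ hr
        have hm := hmid (i + 1) (Fq E i (l + 1)) (by push_cast; exact hf.1) hf.2
        subst h
        push_cast at hm
        simpa only [Nat.add_sub_cancel] using hm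
      · rw [if_neg (by omega), if_neg (by omega)]
        refine le_trans ?_ hr
        have := hconv l (by omega) hl
        nlinarith [mul_nonneg (sub_nonneg.2 this) (sub_nonneg.2 hf.1)]
    · intro l hl
      push_cast
      exact ⟨rec_ge ha0 ha1 hinc hrec hl _ (hG l).1 (hF l hl.le).1 (hF (l + 1) hl).1,
        rec_le ha0 ha1 hinc hrec hl _ (hG l).2 (hF l hl.le).2 (hF (l + 1) hl).2⟩
    · push_cast; exact hL1
    · intro hg l hl
      push_cast at hg ⊢
      have hg1 : 0 ≤ ((i : ℝ) + 1) * c + b := by linarith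
      have hg0 : 0 ≤ (i : ℝ) * c + b := by linarith
      have hK' := hK hg1
      have hE1 : ∀ m, m < C₂ → 0 ≤ E (i + 1) m := by
        intro m hm; have := hL1 m hm; rwa [min_eq_left hg1] at this
      have hE2 : ∀ m, m < C₂ → 0 ≤ E i m := by
        intro m hm; have := hL m hm; rwa [min_eq_left hg0] at this
      have hF1 : ∀ m, m ≤ C₂ → Fq E (i + 1) m = max (E (i + 1) m) 0 := by
        intro m hm
        unfold Fq
        rw [max_eq_right (a := -(E (i + 1) (m - 1)))
          (by have := hE1 (m - 1) (by omega); linarith)]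
        ring
      have hF2 : ∀ m, m < C₂ → Fq E (i + 1) m = E (i + 1) m := by
        intro m hm
        rw [hF1 m hm.le, max_eq_left (hE1 m hm)]
      set g : ℝ := ((i : ℝ) + 1) * c + b with hgdef
      have hstep : ∀ m, m < C₂ → (1 - a m) * (g - E (i + 1) m) =
          a m * ((1 - a m) * (g - Fq E i m)) +
          (1 - a m) * ((1 - a (m + 1)) * (g - Fq E i (m + 1))) := by
        intro m hm
        rw [hrec i m (by omega)]
        unfold Gq
        rw [if_pos hm]; push_cast
        rw [← hgdef]; ring
      have hgnext : ((i : ℝ) + 1 + 1) * c + b = g + c := by rw [hgdef]; ring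
      rw [hgnext]
      have hup : (1 - a l) * (g - E (i + 1) l) ≤ (1 - a (l + 1)) * (g - Fq E i (l + 1)) := by
        rw [hstep l hl]
        nlinarith [mul_nonneg (ha0 l (by omega)) (sub_nonneg.2 (hK' l hl))]
      have hlow : (1 - a (l + 1)) * (g - Fq E i (l + 1)) ≤
          (1 - a (l + 1)) * (g - Fq E (i + 1) (l + 1)) := by
        rcases Nat.lt_or_ge (l + 1) C₂ with h | h
        · rw [hF2 _ h, hstep _ h]
          nlinarith [mul_nonneg (sub_nonneg.2 (ha1 (l + 1) (by omega)))
            (sub_nonneg.2 (hK' (l + 1) h))]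
        · have hl2 : l + 1 = C₂ := by omega
          have h6 : Fq E (i + 1) (l + 1) ≤ Fq E i (l + 1) := by
            rw [hF1 _ hl]
            apply max_le
            · refine rec_le ha0 ha1 hinc hrec (by omega) _ ?_ le_rfl
                (Fq_anti hA (l + 1) (by omega))
              unfold Gq
              rw [if_neg (by omega)]; push_cast
              exact (hF (l + 1) (by omega)).1
            · have := hFL (l + 1) hl
              rwa [min_eq_left hg1] at this
          nlinarith [mul_nonneg (sub_nonneg.2 (ha1 (l + 1) (by omega))) (sub_nonneg.2 h6)]
      rw [hF2 l hl]
      nlinarith [mul_nonneg (sub_nonneg.2 (hinc l (by omega))) (neg_nonneg.2 hc)]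

theorem dRate_pos {C₂ : ℕ} {μ₁ μ₂ : ℝ} (hC2 : 1 ≤ C₂) (hμ₁ : 0 < μ₁) (hμ₂ : 0 < μ₂)
    {k ℓ : ℕ} (h : 1 ≤ k + ℓ) : 0 < dRate C₂ μ₁ μ₂ k ℓ := by
  unfold dRate
  rcases Nat.eq_zero_or_pos k with rfl | hk
  · have : 0 < min ℓ C₂ := by omega
    have : (0 : ℝ) < ((min ℓ C₂ : ℕ) : ℝ) := by exact_mod_cast this
    simp only [Nat.cast_zero, zero_mul, zero_add]
    exact mul_pos this hμ₂
  · have : (0 : ℝ) < (k : ℝ) := by exact_mod_cast hk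
    have h1 := mul_pos this hμ₁
    have h2 : 0 ≤ ((min ℓ C₂ : ℕ) : ℝ) * μ₂ := by positivity
    linarith

/-- One-step recursion of the differences, with no sign assumption. -/
theorem rec_Dv
    (C₁ C₂ : ℕ) (hC₂pos : 1 ≤ C₂) (hC : C₂ < C₁)
    (μ₁ μ₂ h₀ h₁ h₂ : ℝ)
    (hμ₁ : 0 < μ₁) (hμ₂ : 0 < μ₂)
    (v : ℕ → ℕ → ℕ → ℝ) (hv : IsValue C₁ C₂ μ₁ μ₂ h₀ h₁ h₂ v)
    (i k ℓ : ℕ) (hkl : k + ℓ = C₁) (hk : 1 ≤ k) :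
    Dv v (i + 1) k ℓ =
      pCoef C₁ C₂ μ₁ μ₂ k ℓ *
          (((i : ℝ) + 1) * cCoef C₁ C₂ μ₁ μ₂ h₀ ℓ + bCoef C₁ C₂ μ₁ μ₂ h₁ h₂ ℓ)
        + rCoef C₂ μ₁ μ₂ k ℓ * (max (Dv v i k ℓ) 0 - max (-(Dv v i (k + 1) (ℓ - 1))) 0)
        + qCoef C₂ μ₁ μ₂ k ℓ * (max (Dv v i (k - 1) (ℓ + 1)) 0 - max (-(Dv v i k ℓ)) 0) := by
  obtain ⟨m, rfl⟩ : ∃ m, k = m + 1 := ⟨k - 1, by omega⟩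
  obtain ⟨-, -, hv3⟩ := hv
  have e1 := hv3 i (m + 1) ℓ hkl
  have e2 := hv3 i m (ℓ + 1) (by omega)
  have hd1 : 0 < dRate C₂ μ₁ μ₂ (m + 1) ℓ := dRate_pos hC₂pos hμ₁ hμ₂ (by omega)
  have hd2 : 0 < dRate C₂ μ₁ μ₂ m (ℓ + 1) := dRate_pos hC₂pos hμ₁ hμ₂ (by omega)
  have m1 : min (v i (m + 1) ℓ) (v i m (ℓ + 1)) =
      v i (m + 1) ℓ - max (Dv v i (m + 1) ℓ) 0 := by
    simp only [Dv, Nat.add_sub_cancel]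
    rcases le_total (v i (m + 1) ℓ) (v i m (ℓ + 1)) with h | h
    · rw [min_eq_left h, max_eq_right (by linarith)]; ring
    · rw [min_eq_right h, max_eq_left (by linarith)]; ring
  have m1' : min (v i (m + 1) ℓ) (v i m (ℓ + 1)) =
      v i m (ℓ + 1) - max (-(Dv v i (m + 1) ℓ)) 0 := by
    simp only [Dv, Nat.add_sub_cancel]
    rcases le_total (v i (m + 1) ℓ) (v i m (ℓ + 1)) with h | h
    · rw [min_eq_left h, max_eq_left (by linarith)]; ring
    · rw [min_eq_right h, max_eq_right (by linarith)]; ring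
  have m2 : min (v i m (ℓ + 1)) (v i (m - 1) (ℓ + 1 + 1)) =
      v i m (ℓ + 1) - max (Dv v i m (ℓ + 1)) 0 := by
    simp only [Dv]
    rcases le_total (v i m (ℓ + 1)) (v i (m - 1) (ℓ + 1 + 1)) with h | h
    · rw [min_eq_left h, max_eq_right (by linarith)]; ring
    · rw [min_eq_right h, max_eq_left (by linarith)]; ring
  have m3 : ((min ℓ C₂ : ℕ) : ℝ) * min (v i (m + 1 + 1) (ℓ - 1)) (v i (m + 1) ℓ) =
      ((min ℓ C₂ : ℕ) : ℝ) * (v i (m + 1) ℓ - max (-(Dv v i (m + 1 + 1) (ℓ - 1))) 0) := by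
    rcases Nat.eq_zero_or_pos ℓ with rfl | hl
    · simp
    · congr 1
      have : ℓ - 1 + 1 = ℓ := by omega
      simp only [Dv, Nat.add_sub_cancel, this]
      rcases le_total (v i (m + 1 + 1) (ℓ - 1)) (v i (m + 1) ℓ) with h | h
      · rw [min_eq_left h, max_eq_left (by linarith)]; ring
      · rw [min_eq_right h, max_eq_right (by linarith)]; ring
  have hDdef : Dv v i (m + 1) ℓ =
      max (Dv v i (m + 1) ℓ) 0 - max (-(Dv v i (m + 1) ℓ)) 0 := by
    rcases le_total (Dv v i (m + 1) ℓ) 0 with h | h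
    · rw [max_eq_right h, max_eq_left (by linarith)]; ring
    · rw [max_eq_left h, max_eq_right (by linarith)]; ring
  have hDv : v i (m + 1) ℓ = v i m (ℓ + 1) + max (Dv v i (m + 1) ℓ) 0
      - max (-(Dv v i (m + 1) ℓ)) 0 := by
    have : Dv v i (m + 1) ℓ = v i (m + 1) ℓ - v i m (ℓ + 1) := by
      simp only [Dv, Nat.add_sub_cancel]
    linarith
  simp only [Nat.add_sub_cancel] at e1 e2 ⊢
  rw [m1] at e1
  rw [m2, m1'] at e2
  have e1' : v (i + 1) (m + 1) ℓ =
      (((i : ℝ) + 1) * h₀ + ((m + 1 : ℕ) : ℝ) * h₁ + (ℓ : ℝ) * h₂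
      + ((m + 1 : ℕ) : ℝ) * μ₁ * (v i (m + 1) ℓ - max (Dv v i (m + 1) ℓ) 0)
      + ((min ℓ C₂ : ℕ) : ℝ) * (v i (m + 1) ℓ - max (-(Dv v i (m + 1 + 1) (ℓ - 1))) 0) * μ₂)
      / dRate C₂ μ₁ μ₂ (m + 1) ℓ := by
    rw [e1, ← m3]; ring
  have e0 : Dv v (i + 1) (m + 1) ℓ = v (i + 1) (m + 1) ℓ - v (i + 1) m (ℓ + 1) := by
    simp only [Dv, Nat.add_sub_cancel]
  rw [e0, e1', e2, hDv]
  generalize max (Dv v i (m + 1) ℓ) 0 = A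
  generalize max (-(Dv v i (m + 1) ℓ)) 0 = B
  generalize max (-(Dv v i (m + 1 + 1) (ℓ - 1))) 0 = Z
  generalize max (Dv v i m (ℓ + 1)) 0 = Y
  generalize v i m (ℓ + 1) = V
  have hN : (C₁ : ℝ) = (m : ℝ) + 1 + ℓ := by rw [← hkl]; push_cast; ring
  have hNp : (m : ℝ) + 1 + ℓ ≠ 0 := by positivity
  have hC2p : (C₂ : ℝ) ≠ 0 := by
    have : C₂ ≠ 0 := by omega
    exact_mod_cast this
  simp only [pCoef, qCoef, rCoef, bCoef, cCoef, Nat.add_sub_cancel, hN]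
  simp only [dRate] at *
  rcases Nat.lt_or_ge ℓ C₂ with h | h
  · simp only [if_pos h]
    rw [min_eq_left h.le, min_eq_left (show ℓ + 1 ≤ C₂ from h)] at *
    push_cast at *
    have := hd1.ne'
    have := hd2.ne'
    field_simp
    ring
  · simp only [if_neg (not_lt.2 h)]
    rw [min_eq_right h, min_eq_right (show C₂ ≤ ℓ + 1 by omega)] at *
    push_cast at *
    have := hd1.ne'
    have := hd2.ne'
    field_simp
    ring

/-- Cost of clearing `l` downstream jobs. -/
noncomputable def Wq (C₂ : ℕ) (μ₂ h₂ : ℝ) (l : ℕ) : ℝ :=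
  ∑ j ∈ Finset.range l, ((j : ℝ) + 1) * h₂ / (((min (j + 1) C₂ : ℕ) : ℝ) * μ₂)

theorem v_zero
    (C₁ C₂ : ℕ) (hC₂pos : 1 ≤ C₂)
    (μ₁ μ₂ h₀ h₁ h₂ : ℝ)
    (hμ₁ : 0 < μ₁) (hμ₂ : 0 < μ₂)
    (v : ℕ → ℕ → ℕ → ℝ) (hv : IsValue C₁ C₂ μ₁ μ₂ h₀ h₁ h₂ v) (n : ℕ) :
    ∀ k ℓ : ℕ, k + ℓ = n → k + ℓ ≤ C₁ → v 0 k ℓ = (k : ℝ) * h₁ / μ₁ + Wq C₂ μ₂ h₂ ℓ := by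
  induction n with
  | zero =>
    intro k ℓ h _
    obtain ⟨rfl, rfl⟩ : k = 0 ∧ ℓ = 0 := by omega
    rw [hv.1]; simp [Wq]
  | succ n ih =>
    intro k ℓ h hle
    have hd : 0 < dRate C₂ μ₁ μ₂ k ℓ := dRate_pos hC₂pos hμ₁ hμ₂ (by omega)
    rw [hv.2.1 k ℓ hle (by omega)]
    have t1 : (k : ℝ) * μ₁ / dRate C₂ μ₁ μ₂ k ℓ * v 0 (k - 1) ℓ =
        (k : ℝ) * μ₁ / dRate C₂ μ₁ μ₂ k ℓ *
          ((k : ℝ) * h₁ / μ₁ + Wq C₂ μ₂ h₂ ℓ - h₁ / μ₁) := by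
      rcases Nat.eq_zero_or_pos k with rfl | hk
      · simp
      · obtain ⟨m, rfl⟩ : ∃ m, k = m + 1 := ⟨k - 1, by omega⟩
        rw [Nat.add_sub_cancel, ih m ℓ (by omega) (by omega)]
        push_cast; ring
    have t2 : ((min ℓ C₂ : ℕ) : ℝ) * μ₂ / dRate C₂ μ₁ μ₂ k ℓ * v 0 k (ℓ - 1) =
        ((min ℓ C₂ : ℕ) : ℝ) * μ₂ / dRate C₂ μ₁ μ₂ k ℓ *
          ((k : ℝ) * h₁ / μ₁ + Wq C₂ μ₂ h₂ ℓ) - (ℓ : ℝ) * h₂ / dRate C₂ μ₁ μ₂ k ℓ := by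
      rcases Nat.eq_zero_or_pos ℓ with rfl | hk
      · simp
      · obtain ⟨m, rfl⟩ : ∃ m, ℓ = m + 1 := ⟨ℓ - 1, by omega⟩
        rw [Nat.add_sub_cancel, ih k m (by omega) (by omega)]
        have : Wq C₂ μ₂ h₂ (m + 1) = Wq C₂ μ₂ h₂ m +
          ((m : ℝ) + 1) * h₂ / (((min (m + 1) C₂ : ℕ) : ℝ) * μ₂) := by
          simp only [Wq, Finset.sum_range_succ]
        rw [this]
        have hm : 0 < min (m + 1) C₂ := by omega
        have hm' : (0 : ℝ) < ((min (m + 1) C₂ : ℕ) : ℝ) := by exact_mod_cast hm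
        generalize ((min (m + 1) C₂ : ℕ) : ℝ) = M at *
        push_cast
        field_simp
        ring
    rw [t1, t2]
    have hd' : dRate C₂ μ₁ μ₂ k ℓ = (k : ℝ) * μ₁ + ((min ℓ C₂ : ℕ) : ℝ) * μ₂ := rfl
    generalize ((min ℓ C₂ : ℕ) : ℝ) = M at *
    generalize dRate C₂ μ₁ μ₂ k ℓ = d at *
    field_simp
    rw [hd']
    ring

theorem Dv_zero
    (C₁ C₂ : ℕ) (hC₂pos : 1 ≤ C₂)
    (μ₁ μ₂ h₀ h₁ h₂ : ℝ)
    (hμ₁ : 0 < μ₁) (hμ₂ : 0 < μ₂)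
    (v : ℕ → ℕ → ℕ → ℝ) (hv : IsValue C₁ C₂ μ₁ μ₂ h₀ h₁ h₂ v)
    (k ℓ : ℕ) (hk : 1 ≤ k) (hkl : k + ℓ = C₁) :
    Dv v 0 k ℓ = h₁ / μ₁ - ((ℓ : ℝ) + 1) * h₂ / (((min (ℓ + 1) C₂ : ℕ) : ℝ) * μ₂) := by
  obtain ⟨m, rfl⟩ : ∃ m, k = m + 1 := ⟨k - 1, by omega⟩
  simp only [Dv, Nat.add_sub_cancel]
  rw [v_zero C₁ C₂ hC₂pos μ₁ μ₂ h₀ h₁ h₂ hμ₁ hμ₂ v hv _ _ _ rfl (by omega),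
    v_zero C₁ C₂ hC₂pos μ₁ μ₂ h₀ h₁ h₂ hμ₁ hμ₂ v hv _ m (ℓ + 1) rfl (by omega)]
  simp only [Wq, Finset.sum_range_succ]
  push_cast
  ring

/-- `a_l = r_k` with `k = N - l`. -/
noncomputable def aq (N C₂ : ℕ) (μ₁ μ₂ : ℝ) (l : ℕ) : ℝ := rCoef C₂ μ₁ μ₂ (N - l) l

/-- `d_l`. -/
noncomputable def dq (N C₂ : ℕ) (μ₁ μ₂ : ℝ) (l : ℕ) : ℝ := dRate C₂ μ₁ μ₂ (N - l) l

theorem dq_lt {N C₂ : ℕ} {μ₁ μ₂ : ℝ} {l : ℕ} (h : l < C₂) (hl : l < N) :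
    dq N C₂ μ₁ μ₂ (l + 1) = dq N C₂ μ₁ μ₂ l - μ₁ + μ₂ := by
  obtain ⟨m, rfl⟩ : ∃ m, N = m + 1 + l := ⟨N - l - 1, by omega⟩
  simp only [dq, dRate]
  rw [min_eq_left h.le, min_eq_left (show l + 1 ≤ C₂ from h),
    show m + 1 + l - (l + 1) = m by omega, show m + 1 + l - l = m + 1 by omega]
  push_cast; ring

theorem dq_ge {N C₂ : ℕ} {μ₁ μ₂ : ℝ} {l : ℕ} (h : C₂ ≤ l) (hl : l < N) :
    dq N C₂ μ₁ μ₂ (l + 1) = dq N C₂ μ₁ μ₂ l - μ₁ := by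
  obtain ⟨m, rfl⟩ : ∃ m, N = m + 1 + l := ⟨N - l - 1, by omega⟩
  simp only [dq, dRate]
  rw [min_eq_right h, min_eq_right (show C₂ ≤ l + 1 by omega),
    show m + 1 + l - (l + 1) = m by omega, show m + 1 + l - l = m + 1 by omega]
  push_cast; ring

theorem q_eq {N C₂ : ℕ} {μ₁ μ₂ : ℝ} (hC2 : 1 ≤ C₂) (hμ₁ : 0 < μ₁) (hμ₂ : 0 < μ₂) {l : ℕ}
    (hl : l < N) : qCoef C₂ μ₁ μ₂ (N - l) l = 1 - aq N C₂ μ₁ μ₂ (l + 1) := by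
  have hd : 0 < dRate C₂ μ₁ μ₂ (N - l - 1) (l + 1) := dRate_pos hC2 hμ₁ hμ₂ (by omega)
  simp only [aq, rCoef, qCoef]
  rw [show N - (l + 1) = N - l - 1 by omega, eq_sub_iff_add_eq, ← add_div]
  exact div_self hd.ne'

theorem p_eq {N C₂ : ℕ} {μ₁ μ₂ : ℝ} (hC2 : 1 ≤ C₂) (hμ₁ : 0 < μ₁) (hμ₂ : 0 < μ₂) {l : ℕ}
    (hl : l < N) :
    pCoef N C₂ μ₁ μ₂ (N - l) l = aq N C₂ μ₁ μ₂ (l + 1) - aq N C₂ μ₁ μ₂ l := by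
  have hd1 : 0 < dRate C₂ μ₁ μ₂ (N - l) l := dRate_pos hC2 hμ₁ hμ₂ (by omega)
  have hd2 : 0 < dRate C₂ μ₁ μ₂ (N - l - 1) (l + 1) := dRate_pos hC2 hμ₁ hμ₂ (by omega)
  obtain ⟨m, rfl⟩ : ∃ m, N = m + 1 + l := ⟨N - l - 1, by omega⟩
  simp only [aq, rCoef, pCoef]
  rw [show m + 1 + l - (l + 1) = m by omega]
  rw [show m + 1 + l - l = m + 1 by omega] at *
  simp only [Nat.add_sub_cancel, dRate] at *
  rcases Nat.lt_or_ge l C₂ with h | h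
  · simp only [if_pos h]
    rw [min_eq_left h.le, min_eq_left (show l + 1 ≤ C₂ from h)] at *
    push_cast at *
    have := hd1.ne'
    have := hd2.ne'
    field_simp
    ring
  · simp only [if_neg (not_lt.2 h)]
    rw [min_eq_right h, min_eq_right (show C₂ ≤ l + 1 by omega)] at *
    push_cast at *
    have := hd1.ne'
    have := hd2.ne'
    field_simp
    ring

theorem p_eq' {N C₂ : ℕ} {μ₁ μ₂ : ℝ} (hC2 : 1 ≤ C₂) (hμ₁ : 0 < μ₁) (hμ₂ : 0 < μ₂) {l : ℕ}
    (hl : l < N) :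
    aq N C₂ μ₁ μ₂ (l + 1) - aq N C₂ μ₁ μ₂ l = (if l < C₂ then (N : ℝ) else (C₂ : ℝ)) * μ₁ * μ₂ /
      (dq N C₂ μ₁ μ₂ l * dq N C₂ μ₁ μ₂ (l + 1)) := by
  rw [← p_eq hC2 hμ₁ hμ₂ hl]
  simp only [pCoef, dq]
  rw [show N - (l + 1) = N - l - 1 by omega]

/-- The differences indexed by `l`, extended constantly to `l = N`. -/
noncomputable def Eq' (N : ℕ) (v : ℕ → ℕ → ℕ → ℝ) (i l : ℕ) : ℝ :=
  Dv v i (N - min l (N - 1)) (min l (N - 1))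

theorem Eq'_lt {N : ℕ} {v : ℕ → ℕ → ℕ → ℝ} {i l : ℕ} (h : l < N) :
    Eq' N v i l = Dv v i (N - l) l := by
  unfold Eq'
  rw [min_eq_left (by omega)]

theorem aq_zero {N C₂ : ℕ} {μ₁ μ₂ : ℝ} : aq N C₂ μ₁ μ₂ 0 = 0 := by
  simp [aq, rCoef]

theorem aq_N {N C₂ : ℕ} {μ₁ μ₂ : ℝ} (hN : 1 ≤ N) (hC2 : 1 ≤ C₂) (hμ₁ : 0 < μ₁) (hμ₂ : 0 < μ₂) :
    aq N C₂ μ₁ μ₂ N = 1 := by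
  have h := q_eq (N := N) hC2 hμ₁ hμ₂ (l := N - 1) (by omega)
  rw [show N - 1 + 1 = N by omega, show N - (N - 1) = 1 by omega] at h
  simp [qCoef] at h
  linarith

theorem recE_v
    (C₁ C₂ : ℕ) (hC₂pos : 1 ≤ C₂) (hC : C₂ < C₁)
    (μ₁ μ₂ h₀ h₁ h₂ : ℝ)
    (hμ₁ : 0 < μ₁) (hμ₂ : 0 < μ₂)
    (v : ℕ → ℕ → ℕ → ℝ) (hv : IsValue C₁ C₂ μ₁ μ₂ h₀ h₁ h₂ v) :
    RecE C₁ C₂ (aq C₁ C₂ μ₁ μ₂) (h₁ / μ₁ - h₂ / μ₂) (h₀ / (C₁ : ℝ) * (1 / μ₁ - 1 / μ₂))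
      ((h₁ - h₂) / μ₁ - (C₁ : ℝ) * h₂ / ((C₂ : ℝ) * μ₂)) (-h₀ / ((C₂ : ℝ) * μ₂))
      (Eq' C₁ v) := by
  intro i l hl
  rw [Eq'_lt hl, rec_Dv C₁ C₂ hC₂pos hC μ₁ μ₂ h₀ h₁ h₂ hμ₁ hμ₂ v hv i (C₁ - l) l (by omega)
    (by omega), p_eq hC₂pos hμ₁ hμ₂ hl, q_eq hC₂pos hμ₁ hμ₂ hl]
  have hg : ((i : ℝ) + 1) * cCoef C₁ C₂ μ₁ μ₂ h₀ l + bCoef C₁ C₂ μ₁ μ₂ h₁ h₂ l =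
      Gq C₂ (h₁ / μ₁ - h₂ / μ₂) (h₀ / (C₁ : ℝ) * (1 / μ₁ - 1 / μ₂))
      ((h₁ - h₂) / μ₁ - (C₁ : ℝ) * h₂ / ((C₂ : ℝ) * μ₂)) (-h₀ / ((C₂ : ℝ) * μ₂)) (i + 1) l := by
    simp only [Gq, cCoef, bCoef]
    push_cast
    split_ifs <;> rfl
  rw [hg]
  have t1 : rCoef C₂ μ₁ μ₂ (C₁ - l) l * (max (Dv v i (C₁ - l) l) 0
      - max (-(Dv v i (C₁ - l + 1) (l - 1))) 0) = aq C₁ C₂ μ₁ μ₂ l * Fq (Eq' C₁ v) i l := by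
    rcases Nat.eq_zero_or_pos l with rfl | h0
    · simp [aq, rCoef]
    · unfold aq Fq
      rw [Eq'_lt hl, Eq'_lt (show l - 1 < C₁ by omega), show C₁ - (l - 1) = C₁ - l + 1 by omega]
  have t2 : (1 - aq C₁ C₂ μ₁ μ₂ (l + 1)) * (max (Dv v i (C₁ - l - 1) (l + 1)) 0
      - max (-(Dv v i (C₁ - l) l)) 0) =
      (1 - aq C₁ C₂ μ₁ μ₂ (l + 1)) * Fq (Eq' C₁ v) i (l + 1) := by
    rcases Nat.lt_or_ge (l + 1) C₁ with h | h
    · unfold Fq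
      rw [Eq'_lt h, Nat.add_sub_cancel, Eq'_lt hl, show C₁ - (l + 1) = C₁ - l - 1 by omega]
    · rw [show l + 1 = C₁ by omega, aq_N (by omega) hC₂pos hμ₁ hμ₂]; simp
  rw [t1, t2]

theorem anti_v
    (C₁ C₂ : ℕ) (hC₂pos : 1 ≤ C₂) (hC : C₂ < C₁)
    (μ₁ μ₂ h₀ h₁ h₂ : ℝ)
    (hμ₁ : 0 < μ₁) (hμ₂ : 0 < μ₂)
    (hh₀ : 0 < h₀) (hh₁ : 0 < h₁) (hh₂ : 0 < h₂)
    (v : ℕ → ℕ → ℕ → ℝ) (hv : IsValue C₁ C₂ μ₁ μ₂ h₀ h₁ h₂ v) (i : ℕ) :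
    AntiE C₁ (Eq' C₁ v) i := by
  have hrec := recE_v C₁ C₂ hC₂pos hC μ₁ μ₂ h₀ h₁ h₂ hμ₁ hμ₂ v hv
  have hE : ∀ i, Eq' C₁ v i C₁ = Eq' C₁ v i (C₁ - 1) := by
    intro i; unfold Eq'; simp
  have hN0 : (0 : ℝ) < C₁ := by
    have : 0 < C₁ := by omega
    exact_mod_cast this
  have hK0 : (0 : ℝ) < C₂ := by exact_mod_cast hC₂pos
  have hKN : (C₂ : ℝ) < C₁ := by exact_mod_cast hC
  have hdp : ∀ l, l ≤ C₁ → 0 < dq C₁ C₂ μ₁ μ₂ l := fun l hl =>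
    dRate_pos hC₂pos hμ₁ hμ₂ (by omega)
  have hinc : ∀ l, l < C₁ → aq C₁ C₂ μ₁ μ₂ l ≤ aq C₁ C₂ μ₁ μ₂ (l + 1) := by
    intro l hl
    rw [← sub_nonneg, p_eq' hC₂pos hμ₁ hμ₂ hl]
    have := hdp l hl.le
    have := hdp (l + 1) hl
    split_ifs <;> positivity
  have ha0 : ∀ l, l ≤ C₁ → 0 ≤ aq C₁ C₂ μ₁ μ₂ l := by
    intro l hl
    have h := hdp l hl
    have : 0 ≤ ((min l C₂ : ℕ) : ℝ) * μ₂ := by positivity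
    exact div_nonneg this h.le
  have ha1 : ∀ l, l ≤ C₁ → aq C₁ C₂ μ₁ μ₂ l ≤ 1 := by
    intro l hl
    have h := hdp l hl
    unfold aq rCoef
    unfold dq at h
    rw [div_le_one h]
    unfold dRate
    have : 0 ≤ ((C₁ - l : ℕ) : ℝ) * μ₁ := by positivity
    linarith
  -- comparing consecutive increments reduces to comparing rates
  have hcmp : ∀ (P x y z : ℝ), 0 ≤ P → 0 < x → 0 < y → 0 < z → z ≤ x →
      P / (x * y) ≤ P / (y * z) := by
    intro P x y z hP hx hy hz hzx
    apply div_le_div_of_nonneg_left hP (by positivity)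
    nlinarith
  have hcmp' : ∀ (P x y z : ℝ), 0 ≤ P → 0 < x → 0 < y → 0 < z → x ≤ z →
      P / (y * z) ≤ P / (x * y) := by
    intro P x y z hP hx hy hz hzx
    apply div_le_div_of_nonneg_left hP (by positivity)
    nlinarith
  have hconv : ∀ l, C₂ ≤ l → l + 1 < C₁ →
      aq C₁ C₂ μ₁ μ₂ (l + 1) - aq C₁ C₂ μ₁ μ₂ l ≤
      aq C₁ C₂ μ₁ μ₂ (l + 2) - aq C₁ C₂ μ₁ μ₂ (l + 1) := by
    intro l h hl
    rw [p_eq' hC₂pos hμ₁ hμ₂ (show l < C₁ by omega), p_eq' hC₂pos hμ₁ hμ₂ hl,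
      if_neg (by omega), if_neg (by omega)]
    refine hcmp _ _ _ _ (by positivity) (hdp _ (by omega)) (hdp _ hl.le) (hdp _ hl) ?_
    rw [dq_ge (by omega) hl, dq_ge h (by omega)]
    linarith
  have hbb : (h₁ - h₂) / μ₁ - (C₁ : ℝ) * h₂ / ((C₂ : ℝ) * μ₂) ≤ h₁ / μ₁ - h₂ / μ₂ := by
    have e1 : h₂ / μ₂ ≤ (C₁ : ℝ) * h₂ / ((C₂ : ℝ) * μ₂) := by
      rw [div_le_div_iff₀ hμ₂ (by positivity)]
      nlinarith [mul_pos hh₂ hμ₂]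
    have e2 : (h₁ - h₂) / μ₁ ≤ h₁ / μ₁ := by
      apply div_le_div_of_nonneg_right _ hμ₁.le; linarith
    linarith
  have hD0 : ∀ l, l < C₁ → Eq' C₁ v 0 l =
      h₁ / μ₁ - ((l : ℝ) + 1) * h₂ / (((min (l + 1) C₂ : ℕ) : ℝ) * μ₂) := by
    intro l hl
    rw [Eq'_lt hl, Dv_zero C₁ C₂ hC₂pos μ₁ μ₂ h₀ h₁ h₂ hμ₁ hμ₂ v hv _ _ (by omega) (by omega)]
  have hE0' : ∀ l, l < C₂ → Eq' C₁ v 0 l = h₁ / μ₁ - h₂ / μ₂ := by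
    intro l hl
    rw [hD0 l (by omega), min_eq_left (show l + 1 ≤ C₂ from hl)]
    push_cast
    rw [mul_div_mul_left _ _ (by positivity)]
  have hE0'' : ∀ l, C₂ ≤ l → l < C₁ → Eq' C₁ v 0 l =
      h₁ / μ₁ - ((l : ℝ) + 1) * h₂ / ((C₂ : ℝ) * μ₂) := by
    intro l hl hl'
    rw [hD0 l (by omega), min_eq_right (show C₂ ≤ l + 1 by omega)]
  have hE0 : ∀ l, l < C₁ → (h₁ - h₂) / μ₁ - (C₁ : ℝ) * h₂ / ((C₂ : ℝ) * μ₂) ≤ Eq' C₁ v 0 l ∧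
      Eq' C₁ v 0 l ≤ h₁ / μ₁ - h₂ / μ₂ := by
    intro l hl
    rcases Nat.lt_or_ge l C₂ with h | h
    · rw [hE0' l h]; exact ⟨hbb, le_rfl⟩
    · rw [hE0'' l h hl]
      have l1 : (l : ℝ) + 1 ≤ C₁ := by exact_mod_cast hl
      have l2 : (C₂ : ℝ) ≤ (l : ℝ) := by exact_mod_cast h
      have e1 : ((l : ℝ) + 1) * h₂ / ((C₂ : ℝ) * μ₂) ≤ (C₁ : ℝ) * h₂ / ((C₂ : ℝ) * μ₂) := by
        gcongr
      have e2 : (h₁ - h₂) / μ₁ ≤ h₁ / μ₁ := by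
        apply div_le_div_of_nonneg_right _ hμ₁.le; linarith
      have e3 : h₂ / μ₂ ≤ ((l : ℝ) + 1) * h₂ / ((C₂ : ℝ) * μ₂) := by
        rw [div_le_div_iff₀ hμ₂ (by positivity)]
        nlinarith [mul_pos hh₂ hμ₂]
      constructor <;> linarith
  have hanti0 : AntiE C₁ (Eq' C₁ v) 0 := by
    intro l h1 hl
    rcases Nat.lt_or_ge l C₁ with h | h
    · rcases Nat.lt_or_ge (l - 1) C₂ with h2 | h2
      · rw [hE0' _ h2]; exact (hE0 l h).2
      · rw [hE0'' _ h2 (by omega), hE0'' _ (by omega) h]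
        have : ((l - 1 : ℕ) : ℝ) ≤ (l : ℝ) := by exact_mod_cast Nat.sub_le l 1
        gcongr
    · rw [show l = C₁ by omega, hE]
  rcases le_total μ₁ μ₂ with hμ | hμ
  · have hc : 0 ≤ h₀ / (C₁ : ℝ) * (1 / μ₁ - 1 / μ₂) := by
      have := one_div_le_one_div_of_le hμ₁ hμ
      exact mul_nonneg (by positivity) (by linarith)
    have hc' : -h₀ / ((C₂ : ℝ) * μ₂) ≤ 0 :=
      div_nonpos_of_nonpos_of_nonneg (by linarith) (by positivity)
    refine (anti_pos hC₂pos hC hE ha0 ha1 hinc hconv ?_ hrec hc hc' hbb hanti0 hE0 i).1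
    intro l hl
    rw [p_eq' hC₂pos hμ₁ hμ₂ (show l < C₁ by omega),
      p_eq' hC₂pos hμ₁ hμ₂ (show l + 1 < C₁ by omega), if_pos (by omega), if_pos (by omega)]
    refine hcmp' _ _ _ _ (by positivity) (hdp _ (by omega)) (hdp _ (by omega))
      (hdp _ (by omega)) ?_
    rw [dq_lt hl (by omega), dq_lt (show l < C₂ by omega) (by omega)]
    linarith
  · have hinv := one_div_le_one_div_of_le hμ₂ hμ
    have hc : h₀ / (C₁ : ℝ) * (1 / μ₁ - 1 / μ₂) ≤ 0 :=
      mul_nonpos_of_nonneg_of_nonpos (by positivity) (by linarith)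
    have hcc : -h₀ / ((C₂ : ℝ) * μ₂) ≤ h₀ / (C₁ : ℝ) * (1 / μ₁ - 1 / μ₂) := by
      have e1 : h₀ / ((C₁ : ℝ) * μ₂) ≤ h₀ / ((C₂ : ℝ) * μ₂) := by gcongr
      have e2 : 0 ≤ h₀ / (C₁ : ℝ) * (1 / μ₁) := by positivity
      have e3 : h₀ / ((C₁ : ℝ) * μ₂) = h₀ / (C₁ : ℝ) * (1 / μ₂) := by field_simp
      rw [neg_div, mul_sub]
      linarith
    refine (anti_neg hC₂pos hC hE ha0 ha1 hinc hconv ?_ ?_ hrec hc hcc hbb hanti0 hE0 hE0' i).1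
    · intro l hl
      rw [p_eq' hC₂pos hμ₁ hμ₂ (show l < C₁ by omega),
        p_eq' hC₂pos hμ₁ hμ₂ (show l + 1 < C₁ by omega), if_pos (by omega), if_pos (by omega)]
      refine hcmp _ _ _ _ (by positivity) (hdp _ (by omega)) (hdp _ (by omega))
        (hdp _ (by omega)) ?_
      rw [dq_lt hl (by omega), dq_lt (show l < C₂ by omega) (by omega)]
      linarith
    · intro j x hx1 hx2
      have p1 := p_eq' hC₂pos hμ₁ hμ₂ (show C₂ - 1 < C₁ by omega)
      have p2 := p_eq' hC₂pos hμ₁ hμ₂ hC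
      have q1 := dq_lt (μ₁ := μ₁) (μ₂ := μ₂) (show C₂ - 1 < C₂ by omega)
        (show C₂ - 1 < C₁ by omega)
      have q2 := dq_ge (μ₁ := μ₁) (μ₂ := μ₂) (le_refl C₂) hC
      rw [show C₂ - 1 + 1 = C₂ by omega] at p1 q1
      rw [if_pos (by omega)] at p1
      rw [if_neg (by omega)] at p2
      rw [p1, p2]
      have d0 := hdp (C₂ - 1) (by omega)
      have d1 := hdp C₂ (by omega)
      have d2 := hdp (C₂ + 1) (by omega)
      have d02 : dq C₁ C₂ μ₁ μ₂ (C₂ + 1) ≤ dq C₁ C₂ μ₁ μ₂ (C₂ - 1) := by linarith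
      generalize dq C₁ C₂ μ₁ μ₂ (C₂ - 1) = D0 at *
      generalize dq C₁ C₂ μ₁ μ₂ C₂ = D1 at *
      generalize dq C₁ C₂ μ₁ μ₂ (C₂ + 1) = D2 at *
      have hxh : x ≤ h₁ / μ₁ := by
        have : 0 ≤ h₂ / μ₂ := by positivity
        linarith
      set g : ℝ := (j : ℝ) * (h₀ / (C₁ : ℝ) * (1 / μ₁ - 1 / μ₂)) + (h₁ / μ₁ - h₂ / μ₂) with hg
      set g' : ℝ := (j : ℝ) * (-h₀ / ((C₂ : ℝ) * μ₂)) +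
        ((h₁ - h₂) / μ₁ - (C₁ : ℝ) * h₂ / ((C₂ : ℝ) * μ₂)) with hg'
      have hkey : (C₁ : ℝ) * g - (C₂ : ℝ) * g' =
          (j * h₀ + C₂ * h₂) / μ₁ + ((C₁ : ℝ) - C₂) * (h₁ / μ₁) := by
        rw [hg, hg']; field_simp; ring
      have hk2 : (C₁ : ℝ) * (x - g) ≤ (C₂ : ℝ) * (x - g') := by
        have e1 : 0 ≤ (j * h₀ + C₂ * h₂) / μ₁ := by positivity
        have e2 := mul_nonneg (sub_nonneg.2 hKN.le) (sub_nonneg.2 hxh)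
        nlinarith
      have hfin : (C₁ : ℝ) * (x - g) * D2 ≤ (C₂ : ℝ) * (x - g') * D0 := by
        have e3 : 0 ≤ (C₂ : ℝ) * (x - g') := mul_nonneg hK0.le (by linarith)
        calc (C₁ : ℝ) * (x - g) * D2 ≤ (C₂ : ℝ) * (x - g') * D2 := by gcongr
          _ ≤ _ := by gcongr
      have : (C₁ : ℝ) * μ₁ * μ₂ / (D0 * D1) * (x - g) + (C₂ : ℝ) * μ₁ * μ₂ / (D1 * D2) * (g' - x)
          = - (μ₁ * μ₂ / (D0 * D1 * D2) *
            ((C₂ : ℝ) * (x - g') * D0 - (C₁ : ℝ) * (x - g) * D2)) := by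
        field_simp; ring
      rw [this]
      have := mul_nonneg (show 0 ≤ μ₁ * μ₂ / (D0 * D1 * D2) by positivity) (sub_nonneg.2 hfin)
      linarith

theorem stmt10
    (C₁ C₂ : ℕ) (hC₂pos : 1 ≤ C₂) (hC : C₂ < C₁)
    (μ₁ μ₂ h₀ h₁ h₂ : ℝ)
    (hμ₁ : 0 < μ₁) (hμ₂ : 0 < μ₂)
    (hh₀ : 0 < h₀) (hh₁ : 0 < h₁) (hh₂ : 0 < h₂)
    (v : ℕ → ℕ → ℕ → ℝ) (hv : IsValue C₁ C₂ μ₁ μ₂ h₀ h₁ h₂ v)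
    (i k ℓ : ℕ) (hkl : k + ℓ = C₁) (hk : 1 ≤ k)
    (hD : 0 ≤ Dv v i k ℓ) :
    Dv v (i + 1) k ℓ =
      pCoef C₁ C₂ μ₁ μ₂ k ℓ *
          (((i : ℝ) + 1) * cCoef C₁ C₂ μ₁ μ₂ h₀ ℓ + bCoef C₁ C₂ μ₁ μ₂ h₁ h₂ ℓ)
        + qCoef C₂ μ₁ μ₂ k ℓ * max 0 (Dv v i (k - 1) (ℓ + 1))
        + rCoef C₂ μ₁ μ₂ k ℓ * Dv v i k ℓ := by
  rw [rec_Dv C₁ C₂ hC₂pos hC μ₁ μ₂ h₀ h₁ h₂ hμ₁ hμ₂ v hv i k ℓ hkl hk,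
    max_eq_left hD, max_eq_right (a := -(Dv v i k ℓ)) (by linarith), max_comm 0]
  rcases Nat.eq_zero_or_pos ℓ with rfl | hl
  · simp [rCoef]
  · have hA := anti_v C₁ C₂ hC₂pos hC μ₁ μ₂ h₀ h₁ h₂ hμ₁ hμ₂ hh₀ hh₁ hh₂ v hv i ℓ hl (by omega)
    rw [Eq'_lt (by omega), Eq'_lt (by omega), show C₁ - ℓ = k by omega,
      show C₁ - (ℓ - 1) = k + 1 by omega] at hA
    rw [max_eq_right (a := -(Dv v i (k + 1) (ℓ - 1))) (by linarith)]
    ring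
end
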